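/- arXiv:math/0609563 — 4 statements merged into one kernel-verified Lean document; each statement's English description precedes it below -/
import Mathlib

section
/- For every n ≥ 2, the homomorphism ι : B_n → VB_n defined by ι(σ_i) = σ_i for i = 1, …, n−1 is well defined and injective. -/
/-- The free-group letter corresponding to the braid generator `σ_{i+1}`
(0-based index `i`) of the virtual braid group on `n` strands. -/
def σg (n : ℕ) (i : Fin (n-1)) : FreeGroup (Fin (n-1) ⊕ Fin (n-1)) := FreeGroup.of (Sum.inl i)

/-- The free-group letter corresponding to the virtual generator `ρ_{i+1}`
(0-based index `i`) of the virtual braid group on `n` strands. -/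
def ρg (n : ℕ) (i : Fin (n-1)) : FreeGroup (Fin (n-1) ⊕ Fin (n-1)) := FreeGroup.of (Sum.inr i)

/-- The defining relators of the virtual braid group `VB n`. -/
def vbRels (n : ℕ) : Set (FreeGroup (Fin (n-1) ⊕ Fin (n-1))) :=
  {r | ∃ i j : Fin (n-1),
    ((i:ℕ)+1 = (j:ℕ) ∧ r = σg n i * σg n j * σg n i * (σg n j * σg n i * σg n j)⁻¹) ∨
    (((i:ℕ)+2 ≤ (j:ℕ) ∨ (j:ℕ)+2 ≤ (i:ℕ)) ∧ r = σg n i * σg n j * (σg n j * σg n i)⁻¹) ∨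
    ((i:ℕ)+1 = (j:ℕ) ∧ r = ρg n i * ρg n j * ρg n i * (ρg n j * ρg n i * ρg n j)⁻¹) ∨
    (((i:ℕ)+2 ≤ (j:ℕ) ∨ (j:ℕ)+2 ≤ (i:ℕ)) ∧ r = ρg n i * ρg n j * (ρg n j * ρg n i)⁻¹) ∨
    (r = ρg n i * ρg n i) ∨
    (((i:ℕ)+2 ≤ (j:ℕ) ∨ (j:ℕ)+2 ≤ (i:ℕ)) ∧ r = σg n i * ρg n j * (ρg n j * σg n i)⁻¹) ∨
    ((i:ℕ)+1 = (j:ℕ) ∧ r = ρg n i * ρg n j * σg n i * (σg n j * ρg n i * ρg n j)⁻¹)}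

/-- The virtual braid group on `n` strands, given by its standard presentation. -/
abbrev VB (n : ℕ) : Type := PresentedGroup (vbRels n)

/-- The generator `σ_{i+1}` of `VB n`. -/
def σv (n : ℕ) (i : Fin (n-1)) : VB n := PresentedGroup.of (Sum.inl i)

/-- The generator `ρ_{i+1}` of `VB n`. -/
def ρv (n : ℕ) (i : Fin (n-1)) : VB n := PresentedGroup.of (Sum.inr i)

/-- The transposition `(i+1, i+2)` (0-based: swapping `i` and `i+1`) in `S_n`. -/
def sw (n : ℕ) (i : Fin (n-1)) : Equiv.Perm (Fin n) :=
  Equiv.swap ⟨i.val, by have := i.isLt; omega⟩ ⟨i.val + 1, by have := i.isLt; omega⟩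

/-- `μ : VB n → S_n` sends each `σ_i` to `1` and each `ρ_i` to the transposition `(i, i+1)`.
Its kernel is the normal closure `H_n` of the braid group `B_n` in `VB n`. -/
def IsMu (n : ℕ) (μ : VB n →* Equiv.Perm (Fin n)) : Prop :=
  ∀ i : Fin (n-1), μ (σv n i) = 1 ∧ μ (ρv n i) = sw n i

/-- `ν : VB n → S_n` sends both `σ_i` and `ρ_i` to the transposition `(i, i+1)`.
Its kernel is the virtual pure braid group `VP_n`. -/
def IsNu (n : ℕ) (ν : VB n →* Equiv.Perm (Fin n)) : Prop :=
  ∀ i : Fin (n-1), ν (σv n i) = sw n i ∧ ν (ρv n i) = sw n i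


/-- The defining relators of the Artin braid group `B_n`. -/
def braidRels (n : ℕ) : Set (FreeGroup (Fin (n-1))) :=
  {r | ∃ i j : Fin (n-1),
    ((i:ℕ)+1 = (j:ℕ) ∧ r = FreeGroup.of i * FreeGroup.of j * FreeGroup.of i *
        (FreeGroup.of j * FreeGroup.of i * FreeGroup.of j)⁻¹) ∨
    (((i:ℕ)+2 ≤ (j:ℕ) ∨ (j:ℕ)+2 ≤ (i:ℕ)) ∧
        r = FreeGroup.of i * FreeGroup.of j * (FreeGroup.of j * FreeGroup.of i)⁻¹)}

/-- The Artin braid group on `n` strands, given by its standard presentation. -/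
abbrev BraidGroup (n : ℕ) : Type := PresentedGroup (braidRels n)

/-- Generators satisfying the braid relations on `n` strands, indexed by `ℕ`. -/
structure IsBraidFamily {G : Type*} [Group G] (n : ℕ) (g : ℕ → G) : Prop where
  braid : ∀ x, x + 2 < n → g x * g (x + 1) * g x = g (x + 1) * g x * g (x + 1)
  comm : ∀ x y, x + 2 ≤ y → g x * g y = g y * g x

theorem swap_braid {α : Type*} [DecidableEq α] {i j k : α} (hij : i ≠ j) (hik : i ≠ k)
    (hjk : j ≠ k) :
    Equiv.swap i j * Equiv.swap j k * Equiv.swap i j =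
      Equiv.swap j k * Equiv.swap i j * Equiv.swap j k := by
  have h := Equiv.swap_mul_swap_mul_swap hjk.symm hik.symm
  rw [Equiv.swap_comm k j, Equiv.swap_comm j i] at h
  rw [h, Equiv.swap_comm i k, ← Equiv.swap_mul_swap_mul_swap hij hik]

/-- A state consists of an element of `G`, the positions of the labels, and a level for each pair
of adjacent positions. -/
abbrev BraidState (G : Type*) (n : ℕ) : Type _ := G × Equiv.Perm (Fin n) × (ℕ → ℕ)

namespace BraidState

variable {G : Type*} {n : ℕ}

/-- Change of the levels when labels at positions `a` and `b` are exchanged. -/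
def shift (a b : ℕ) (m : ℕ → ℕ) (y : ℕ) : ℕ :=
  if y + 1 = a ∧ y = b then m y + 1 else if y = a ∧ y + 1 = b then m y - 1 else m y

theorem shift_shift {a b : ℕ} {m : ℕ → ℕ} (h : ¬ (a + 1 = b ∧ m a = 0)) :
    shift b a (shift a b m) = m := by
  funext y
  grind [shift]

theorem shift_comm {a b c d : ℕ} (m : ℕ → ℕ) (hac : a ≠ c) (had : a ≠ d) :
    shift a b (shift c d m) = shift c d (shift a b m) := by
  funext y
  grind [shift]

theorem shift_braid {a b c : ℕ} {m : ℕ → ℕ} (hab : a ≠ b) (hac : a ≠ c) (hbc : b ≠ c)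
    (h₁ : ¬ (a + 1 = b ∧ m a = 0)) (h₂ : ¬ (b + 1 = c ∧ m b = 0)) (h₃ : ¬ (a + 1 = c ∧ m a = 0)) :
    shift b c (shift a c (shift a b m)) = shift a b (shift a c (shift b c m)) := by
  funext y
  grind [shift]

/-- Relabelling of the states. -/
def relabel (c : Equiv.Perm (Fin n)) : Equiv.Perm (BraidState G n) where
  toFun s := (s.1, s.2.1 * c⁻¹, s.2.2)
  invFun s := (s.1, s.2.1 * c, s.2.2)
  left_inv s := by simp
  right_inv s := by simp

theorem relabel_mul (c d : Equiv.Perm (Fin n)) :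
    (relabel (c * d) : Equiv.Perm (BraidState G n)) = relabel c * relabel d := by
  ext s <;> simp [relabel, mul_assoc]

theorem relabel_one : (relabel 1 : Equiv.Perm (BraidState G n)) = 1 := by
  ext s <;> simp [relabel]

variable [Group G]

/-- If label `j` is immediately to the right of label `i` and the level there is zero, multiply by
the corresponding generator; otherwise exchange the two labels. -/
def act (g : ℕ → G) (i j : Fin n) (s : BraidState G n) : BraidState G n :=
  if (s.2.1 i : ℕ) + 1 = s.2.1 j ∧ s.2.2 (s.2.1 i) = 0 then (g (s.2.1 i) * s.1, s.2.1, s.2.2)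
  else (s.1, s.2.1 * Equiv.swap i j, shift (s.2.1 i) (s.2.1 j) s.2.2)

theorem act_of_adj {g : ℕ → G} {i j : Fin n} {b : G} {p : Equiv.Perm (Fin n)} {m : ℕ → ℕ}
    (h : (p i : ℕ) + 1 = p j ∧ m (p i) = 0) : act g i j (b, p, m) = (g (p i) * b, p, m) :=
  if_pos h

theorem act_of_not_adj {g : ℕ → G} {i j : Fin n} {b : G} {p : Equiv.Perm (Fin n)} {m : ℕ → ℕ}
    (h : ¬ ((p i : ℕ) + 1 = p j ∧ m (p i) = 0)) :
    act g i j (b, p, m) = (b, p * Equiv.swap i j, shift (p i) (p j) m) :=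
  if_neg h

theorem act_inv_act (g : ℕ → G) {i j : Fin n} (s : BraidState G n) :
    act g⁻¹ i j (act g i j s) = s := by
  obtain ⟨b, p, m⟩ := s
  by_cases h : (p i : ℕ) + 1 = p j ∧ m (p i) = 0
  · rw [act_of_adj h, act_of_adj h]
    simp
  · rw [act_of_not_adj h, act_of_not_adj]
    · simp [mul_assoc, shift_shift h]
    · simp only [Equiv.Perm.mul_apply, Equiv.swap_apply_left, Equiv.swap_apply_right]
      grind [shift]

/-- `act` as a permutation of the states. -/
def actEquiv (g : ℕ → G) (i j : Fin n) : Equiv.Perm (BraidState G n) where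
  toFun := act g i j
  invFun := act g⁻¹ i j
  left_inv := act_inv_act g
  right_inv s := by simpa using act_inv_act g⁻¹ (i := i) (j := j) s

theorem relabel_mul_actEquiv (g : ℕ → G) (c : Equiv.Perm (Fin n)) (i j : Fin n) :
    relabel c * actEquiv g i j = actEquiv g (c i) (c j) * relabel c := by
  refine Equiv.ext fun ⟨b, p, m⟩ => ?_
  change relabel c (act g i j (b, p, m)) = act g (c i) (c j) (b, p * c⁻¹, m)
  by_cases h : (p i : ℕ) + 1 = p j ∧ m (p i) = 0
  · rw [act_of_adj h, act_of_adj (by simpa using h)]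
    simp [relabel]
  · rw [act_of_not_adj h, act_of_not_adj (by simpa using h)]
    simp [relabel, Equiv.swap_apply_apply, mul_assoc]

theorem actEquiv_comm {g : ℕ → G} (hg : IsBraidFamily n g) {i j k l : Fin n} (hik : i ≠ k)
    (hil : i ≠ l) (hjk : j ≠ k) (hjl : j ≠ l) :
    actEquiv g i j * actEquiv g k l = actEquiv g k l * actEquiv g i j := by
  refine Equiv.ext fun ⟨b, p, m⟩ => ?_
  change act g i j (act g k l (b, p, m)) = act g k l (act g i j (b, p, m))
  have hne : ∀ {u v : Fin n}, u ≠ v → (p u : ℕ) ≠ p v := fun huv h =>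
    huv (p.injective (Fin.ext h))
  have h1 := hne hik
  have h2 := hne hil
  have h3 := hne hjk
  have h4 := hne hjl
  have hsw : Equiv.swap i j * Equiv.swap k l = Equiv.swap k l * Equiv.swap i j :=
    Equiv.Perm.Disjoint.commute (by
      intro x
      by_cases hi : x = i
      · subst hi; right; exact Equiv.swap_apply_of_ne_of_ne hik hil
      by_cases hj : x = j
      · subst hj; right; exact Equiv.swap_apply_of_ne_of_ne hjk hjl
      left; exact Equiv.swap_apply_of_ne_of_ne hi hj)
  have e1 : Equiv.swap k l i = i := Equiv.swap_apply_of_ne_of_ne hik hil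
  have e2 : Equiv.swap k l j = j := Equiv.swap_apply_of_ne_of_ne hjk hjl
  have e3 : Equiv.swap i j k = k := Equiv.swap_apply_of_ne_of_ne hik.symm hjk.symm
  have e4 : Equiv.swap i j l = l := Equiv.swap_apply_of_ne_of_ne hil.symm hjl.symm
  by_cases h : (p i : ℕ) + 1 = p j ∧ m (p i) = 0 <;>
    by_cases h' : (p k : ℕ) + 1 = p l ∧ m (p k) = 0
  · rw [act_of_adj h, act_of_adj h', act_of_adj h, act_of_adj h', ← mul_assoc, ← mul_assoc]
    rcases lt_or_gt_of_ne h1 with hlt | hlt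
    · rw [hg.comm (p i) (p k) (by omega)]
    · rw [hg.comm (p k) (p i) (by omega)]
  · rw [act_of_adj h, act_of_not_adj h', act_of_not_adj h', act_of_adj]
    · simp [e1]
    · simp only [Equiv.Perm.mul_apply, e1, e2]
      grind [shift]
  · rw [act_of_not_adj h, act_of_adj h', act_of_not_adj h, act_of_adj]
    · simp [e3]
    · simp only [Equiv.Perm.mul_apply, e3, e4]
      grind [shift]
  · rw [act_of_not_adj h, act_of_not_adj h', act_of_not_adj, act_of_not_adj]
    · simp [e1, e2, e3, e4, mul_assoc, hsw, shift_comm m h1 h2]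
    · simp only [Equiv.Perm.mul_apply, e3, e4]
      grind [shift]
    · simp only [Equiv.Perm.mul_apply, e1, e2]
      grind [shift]

theorem actEquiv_braid {g : ℕ → G} (hg : IsBraidFamily n g) {i j k : Fin n} (hij : i ≠ j)
    (hik : i ≠ k) (hjk : j ≠ k) :
    actEquiv g i j * actEquiv g j k * actEquiv g i j =
      actEquiv g j k * actEquiv g i j * actEquiv g j k := by
  refine Equiv.ext fun ⟨b, p, m⟩ => ?_
  change act g i j (act g j k (act g i j (b, p, m))) = act g j k (act g i j (act g j k (b, p, m)))
  have hne : ∀ {u v : Fin n}, u ≠ v → (p u : ℕ) ≠ p v := fun huv h =>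
    huv (p.injective (Fin.ext h))
  have h1 := hne hij
  have h2 := hne hik
  have h3 := hne hjk
  have e1 : Equiv.swap i j k = k := Equiv.swap_apply_of_ne_of_ne hik.symm hjk.symm
  have e2 : Equiv.swap j k i = i := Equiv.swap_apply_of_ne_of_ne hij hik
  have hsw : Equiv.swap i j * (Equiv.swap j k * Equiv.swap i j) =
      Equiv.swap j k * (Equiv.swap i j * Equiv.swap j k) := by
    simpa only [mul_assoc] using swap_braid hij hik hjk
  by_cases hs : (p i : ℕ) + 1 = p j ∧ m (p i) = 0
  · by_cases ht : (p j : ℕ) + 1 = p k ∧ m (p j) = 0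
    · simp only [act_of_adj hs, act_of_adj ht]
      have := hg.braid (p i) (by have := (p k).isLt; omega)
      rw [← hs.1, ← mul_assoc, ← mul_assoc, this]
      simp only [mul_assoc]
    · rw [act_of_adj hs, act_of_not_adj ht, act_of_not_adj ht,
        act_of_not_adj (i := i) (j := j), act_of_not_adj (i := i) (j := j), act_of_adj]
      · simp [e2]
      all_goals
        simp only [Equiv.Perm.mul_apply, Equiv.swap_apply_left, Equiv.swap_apply_right, e1, e2]
        grind [shift]
  · by_cases ht : (p j : ℕ) + 1 = p k ∧ m (p j) = 0
    · rw [act_of_not_adj hs, act_of_adj ht, act_of_not_adj hs,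
        act_of_not_adj (i := j) (j := k), act_of_not_adj (i := j) (j := k), act_of_adj]
      · simp [e1, e2]
      all_goals
        simp only [Equiv.Perm.mul_apply, Equiv.swap_apply_left, Equiv.swap_apply_right, e1, e2]
        grind [shift]
    · by_cases hst : (p i : ℕ) + 1 = p k ∧ m (p i) = 0
      · rw [act_of_not_adj hs, act_of_not_adj ht, act_of_adj (i := j) (j := k),
          act_of_not_adj (i := i) (j := j), act_of_adj (i := i) (j := j),
          act_of_not_adj (i := j) (j := k)]
        · simp [e2, mul_assoc, shift_shift hs, shift_shift ht]
        all_goals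
          simp only [Equiv.Perm.mul_apply, Equiv.swap_apply_left, Equiv.swap_apply_right, e1, e2]
          grind [shift]
      · rw [act_of_not_adj hs, act_of_not_adj ht, act_of_not_adj (i := j) (j := k),
          act_of_not_adj (i := i) (j := j), act_of_not_adj (i := i) (j := j),
          act_of_not_adj (i := j) (j := k)]
        · simp [e1, e2, mul_assoc, hsw, shift_braid h1 h2 h3 hs ht hst]
        all_goals
          simp only [Equiv.Perm.mul_apply, Equiv.swap_apply_left, Equiv.swap_apply_right, e1, e2]
          grind [shift]

end BraidState

/-- The generators of `BraidGroup n`, extended by `1` to all of `ℕ`. -/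
def braidGen (n x : ℕ) : BraidGroup n :=
  if h : x < n - 1 then PresentedGroup.of ⟨x, h⟩ else 1

theorem isBraidFamily_braidGen (n : ℕ) : IsBraidFamily n (braidGen n) where
  braid x hx := by
    have h₁ : x < n - 1 := by omega
    have h₂ : x + 1 < n - 1 := by omega
    simp only [braidGen, h₁, h₂, dif_pos]
    have := PresentedGroup.mk_eq_one_iff.mpr (Subgroup.subset_normalClosure
      (show _ ∈ braidRels n from ⟨⟨x, h₁⟩, ⟨x + 1, h₂⟩, Or.inl ⟨rfl, rfl⟩⟩))
    exact mul_inv_eq_one.mp this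
  comm x y hxy := by
    by_cases hy : y < n - 1
    · have hx : x < n - 1 := by omega
      simp only [braidGen, hx, hy, dif_pos]
      have := PresentedGroup.mk_eq_one_iff.mpr (Subgroup.subset_normalClosure
        (show _ ∈ braidRels n from ⟨⟨x, hx⟩, ⟨y, hy⟩, Or.inr ⟨Or.inl hxy, rfl⟩⟩))
      exact mul_inv_eq_one.mp this
    · simp [braidGen, hy]

/-- The strand at the left of the `i`-th generator. -/
def leftStrand {n : ℕ} (i : Fin (n - 1)) : Fin n := ⟨i, by omega⟩

/-- The strand at the right of the `i`-th generator. -/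
def rightStrand {n : ℕ} (i : Fin (n - 1)) : Fin n := ⟨i + 1, by omega⟩

theorem leftStrand_ne_rightStrand {n : ℕ} (i : Fin (n - 1)) : leftStrand i ≠ rightStrand i := by
  simp [leftStrand, rightStrand]

theorem strands_disjoint {n : ℕ} {i j : Fin (n - 1)}
    (h : (i : ℕ) + 2 ≤ j ∨ (j : ℕ) + 2 ≤ i) :
    leftStrand i ≠ leftStrand j ∧ leftStrand i ≠ rightStrand j ∧
      rightStrand i ≠ leftStrand j ∧ rightStrand i ≠ rightStrand j := by
  simp only [leftStrand, rightStrand, ne_eq, Fin.mk.injEq]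
  omega

theorem rightStrand_eq_leftStrand {n : ℕ} {i j : Fin (n - 1)} (h : (i : ℕ) + 1 = j) :
    rightStrand i = leftStrand j :=
  Fin.ext h

theorem sw_eq {n : ℕ} (i : Fin (n - 1)) : sw n i = Equiv.swap (leftStrand i) (rightStrand i) := rfl

theorem leftStrand_ne_rightStrand_of_succ {n : ℕ} {i j : Fin (n - 1)} (h : (i : ℕ) + 1 = j) :
    leftStrand i ≠ rightStrand j := by
  simp only [leftStrand, rightStrand, ne_eq, Fin.mk.injEq]
  omega

theorem sw_braid {n : ℕ} {i j : Fin (n - 1)} (h : (i : ℕ) + 1 = j) :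
    sw n i * sw n j * sw n i = sw n j * sw n i * sw n j := by
  have hij := leftStrand_ne_rightStrand i
  have hjk := leftStrand_ne_rightStrand j
  have hik := leftStrand_ne_rightStrand_of_succ h
  rw [sw_eq, sw_eq, rightStrand_eq_leftStrand h] at *
  exact swap_braid hij hik hjk

/-- The images of the generators of `VB n` as permutations of the states. -/
def vbGenAct (n : ℕ) : Fin (n - 1) ⊕ Fin (n - 1) → Equiv.Perm (BraidState (BraidGroup n) n)
  | Sum.inl i => BraidState.actEquiv (braidGen n) (leftStrand i) (rightStrand i)
  | Sum.inr i => BraidState.relabel (sw n i)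

theorem lift_vbGenAct_eq_one (n : ℕ) : ∀ r ∈ vbRels n, FreeGroup.lift (vbGenAct n) r = 1 := by
  have hg := isBraidFamily_braidGen n
  rintro r ⟨i, j, ⟨h, rfl⟩ | ⟨h, rfl⟩ | ⟨h, rfl⟩ | ⟨h, rfl⟩ | rfl | ⟨h, rfl⟩ | ⟨h, rfl⟩⟩ <;>
    simp only [σg, ρg, map_mul, map_inv, FreeGroup.lift_apply_of, vbGenAct, mul_inv_eq_one]
  · rw [← rightStrand_eq_leftStrand h]
    refine BraidState.actEquiv_braid hg (leftStrand_ne_rightStrand i)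
      (leftStrand_ne_rightStrand_of_succ h) ?_
    rw [rightStrand_eq_leftStrand h]
    exact leftStrand_ne_rightStrand j
  · obtain ⟨h1, h2, h3, h4⟩ := strands_disjoint h
    exact BraidState.actEquiv_comm hg h1 h2 h3 h4
  · simp only [← BraidState.relabel_mul, sw_braid h]
  · simp only [← BraidState.relabel_mul]
    obtain ⟨h1, h2, h3, h4⟩ := strands_disjoint h
    have := Equiv.mul_swap_eq_swap_mul (sw n i) (leftStrand j) (rightStrand j)
    rw [sw_eq i, Equiv.swap_apply_of_ne_of_ne h1.symm h3.symm,
      Equiv.swap_apply_of_ne_of_ne h2.symm h4.symm] at this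
    rw [sw_eq, sw_eq, this]
  · rw [← BraidState.relabel_mul, sw_eq, Equiv.swap_mul_self, BraidState.relabel_one]
  · obtain ⟨h1, h2, h3, h4⟩ := strands_disjoint h
    rw [BraidState.relabel_mul_actEquiv, sw_eq, Equiv.swap_apply_of_ne_of_ne h1 h2,
      Equiv.swap_apply_of_ne_of_ne h3 h4]
  · rw [mul_assoc (BraidState.actEquiv _ _ _), ← BraidState.relabel_mul,
      BraidState.relabel_mul_actEquiv, sw_eq, sw_eq]
    simp only [Equiv.Perm.mul_apply]
    have h1 := leftStrand_ne_rightStrand i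
    have h2 := leftStrand_ne_rightStrand_of_succ h
    have h3 := leftStrand_ne_rightStrand j
    rw [← rightStrand_eq_leftStrand h] at *
    rw [Equiv.swap_apply_of_ne_of_ne h1 h2, Equiv.swap_apply_left, Equiv.swap_apply_left,
      Equiv.swap_apply_of_ne_of_ne h2.symm h3.symm]

theorem lift_σv_eq_one (n : ℕ) : ∀ r ∈ braidRels n, FreeGroup.lift (σv n) r = 1 := by
  rintro r ⟨i, j, ⟨h, rfl⟩ | ⟨h, rfl⟩⟩ <;>
    simp only [map_mul, map_inv, FreeGroup.lift_apply_of, mul_inv_eq_one]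
  · exact mul_inv_eq_one.mp (PresentedGroup.mk_eq_one_iff.mpr (Subgroup.subset_normalClosure
      (show _ ∈ vbRels n from ⟨i, j, Or.inl ⟨h, rfl⟩⟩)))
  · exact mul_inv_eq_one.mp (PresentedGroup.mk_eq_one_iff.mpr (Subgroup.subset_normalClosure
      (show _ ∈ vbRels n from ⟨i, j, Or.inr (Or.inl ⟨h, rfl⟩)⟩)))

/-- For every `n ≥ 2`, the homomorphism `ι : B_n → VB_n` defined by
`ι(σ_i) = σ_i` is well defined and injective. -/
theorem braid_to_virtualBraid_injective (n : ℕ) (hn : 2 ≤ n) :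
    ∃ ι : BraidGroup n →* VB n,
      (∀ i : Fin (n-1), ι (PresentedGroup.of i) = σv n i) ∧ Function.Injective ι := by
  let ι : BraidGroup n →* VB n := PresentedGroup.toGroup (lift_σv_eq_one n)
  let φ : VB n →* Equiv.Perm (BraidState (BraidGroup n) n) :=
    PresentedGroup.toGroup (lift_vbGenAct_eq_one n)
  have hι (i) : ι (PresentedGroup.of i) = σv n i := PresentedGroup.toGroup.of _
  have hφ (i) : φ (σv n i) =
      BraidState.actEquiv (braidGen n) (leftStrand i) (rightStrand i) :=
    PresentedGroup.toGroup.of _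
  have key (x b : BraidGroup n) : φ (ι x) (b, 1, 0) = (x * b, 1, 0) := by
    have hx : x ∈ Subgroup.closure (Set.range (PresentedGroup.of (rels := braidRels n))) := by
      simp
    induction hx using Subgroup.closure_induction generalizing b with
    | mem x hx =>
      obtain ⟨i, rfl⟩ := hx
      rw [hι, hφ]
      change BraidState.act _ _ _ _ = _
      rw [BraidState.act_of_adj ⟨rfl, rfl⟩]
      simp [leftStrand, braidGen]
    | one => simp
    | mul x y _ _ hx hy => simp [hx, hy, mul_assoc]
    | inv x _ hx =>
      rw [map_inv, map_inv, Equiv.Perm.inv_eq_iff_eq, hx]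
      simp
  refine ⟨ι, hι, fun x y hxy => ?_⟩
  have := key x 1
  rw [hxy, key y 1] at this
  simpa using this.symm
end

section
/- For every n ≥ 5, the commutator subgroup Γ_2(VB_n) = [VB_n, VB_n] of the virtual braid group VB_n is perfect, i.e. [Γ_2(VB_n), Γ_2(VB_n)] = Γ_2(VB_n). -/
/-- The relations of the four-generator Artin braid group, together with commuting commutators,
force all four generators to coincide. -/
theorem braid_four_eq {Q : Type*} [Group Q]
    (hQ : ∀ x ∈ commutator Q, ∀ y ∈ commutator Q, Commute x y) {a b c d : Q}
    (hab : a * b * a = b * a * b) (hbc : b * c * b = c * b * c) (hcd : c * d * c = d * c * d)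
    (hac : Commute a c) (had : Commute a d) (hbd : Commute b d) :
    a = b ∧ b = c ∧ c = d := by
  have of_eq {x y : Q} (h : x * y * x = y * x * y) :
      Abelianization.of x = Abelianization.of y := by
    have h' := congrArg Abelianization.of h
    simp only [map_mul] at h'
    rw [mul_comm (Abelianization.of y) (Abelianization.of x)] at h'
    exact mul_left_cancel h'
  have eq_of_commute {x y : Q} (h : x * y * x = y * x * y) (hc : Commute x y) : x = y := by
    rw [← hc.eq] at h
    exact mul_left_cancel h
  have mem {x y : Q} (h : Abelianization.of x = Abelianization.of y) :
      x * y⁻¹ ∈ commutator Q := by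
    rw [← Abelianization.ker_of, MonoidHom.mem_ker, map_mul, map_inv, h, mul_inv_cancel]
  have transfer {s t x : Q} (hst : Abelianization.of s = Abelianization.of t)
      (hx : x ∈ commutator Q) (h : Commute t x) : Commute s x := by
    have := (hQ _ (mem hst) _ hx).mul_left h
    rwa [inv_mul_cancel_right] at this
  have eab := of_eq hab
  have ebc := of_eq hbc
  have ecd := of_eq hcd
  have h₁ : Commute a (a * d⁻¹) := (Commute.refl a).mul_right had.inv_right
  have h₂ : Commute a (d * b⁻¹) := transfer (eab.trans (ebc.trans ecd))
    (mem (ebc.trans ecd).symm) ((Commute.refl d).mul_right hbd.symm.inv_right)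
  have h₃ : Commute d (d * a⁻¹) := (Commute.refl d).mul_right had.symm.inv_right
  have h₄ : Commute d (a * c⁻¹) := transfer (eab.trans (ebc.trans ecd)).symm
    (mem (eab.trans ebc)) ((Commute.refl a).mul_right hac.inv_right)
  have ab : a = b := by
    refine eq_of_commute hab ?_
    have h := (h₁.mul_right h₂).inv_right.mul_right (Commute.refl a)
    simpa [mul_assoc] using h
  have dc : d = c := by
    refine eq_of_commute hcd.symm ?_
    have h := (h₃.mul_right h₄).inv_right.mul_right (Commute.refl d)
    simpa [mul_assoc] using h
  exact ⟨ab, eq_of_commute hbc (ab ▸ hac), dc.symm⟩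

/-- In a group with commuting commutators, any `m ≥ 4` elements satisfying the braid relations
coincide. -/
theorem braid_family_eq {Q : Type*} [Group Q]
    (hQ : ∀ x ∈ commutator Q, ∀ y ∈ commutator Q, Commute x y) {m : ℕ} (hm : 4 ≤ m)
    (f : Fin m → Q)
    (hbraid : ∀ i j : Fin m, (i : ℕ) + 1 = j → f i * f j * f i = f j * f i * f j)
    (hcomm : ∀ i j : Fin m, (i : ℕ) + 2 ≤ j → Commute (f i) (f j)) (i j : Fin m) :
    f i = f j := by
  have window (k : ℕ) (hk : k + 3 < m) := braid_four_eq hQ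
    (hbraid ⟨k, by omega⟩ ⟨k + 1, by omega⟩ rfl)
    (hbraid ⟨k + 1, by omega⟩ ⟨k + 2, by omega⟩ rfl)
    (hbraid ⟨k + 2, by omega⟩ ⟨k + 3, hk⟩ rfl)
    (hcomm _ _ le_rfl) (hcomm _ _ (by simp)) (hcomm _ _ le_rfl)
  have step (k : ℕ) (hk : k + 1 < m) : f ⟨k, by omega⟩ = f ⟨k + 1, hk⟩ := by
    by_cases h₀ : k + 3 < m
    · exact (window k h₀).1
    by_cases h₁ : k + 2 < m
    · obtain ⟨l, rfl⟩ : ∃ l, k = l + 1 := ⟨k - 1, by omega⟩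
      exact (window l (by omega)).2.1
    · obtain ⟨l, rfl⟩ : ∃ l, k = l + 2 := ⟨k - 2, by omega⟩
      exact (window l (by omega)).2.2
  have base (k : ℕ) (hk : k < m) : f ⟨k, hk⟩ = f ⟨0, by omega⟩ := by
    induction k with
    | zero => rfl
    | succ k ih => rw [← step k hk, ih]
  exact (base i i.2).trans (base j j.2).symm

theorem σv_braid {n : ℕ} {i j : Fin (n - 1)} (h : (i : ℕ) + 1 = j) :
    σv n i * σv n j * σv n i = σv n j * σv n i * σv n j :=
  PresentedGroup.mk_eq_mk_of_mul_inv_mem ⟨i, j, .inl ⟨h, rfl⟩⟩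

theorem σv_commute {n : ℕ} {i j : Fin (n - 1)} (h : (i : ℕ) + 2 ≤ j) :
    Commute (σv n i) (σv n j) :=
  PresentedGroup.mk_eq_mk_of_mul_inv_mem ⟨i, j, .inr <| .inl ⟨.inl h, rfl⟩⟩

theorem ρv_braid {n : ℕ} {i j : Fin (n - 1)} (h : (i : ℕ) + 1 = j) :
    ρv n i * ρv n j * ρv n i = ρv n j * ρv n i * ρv n j :=
  PresentedGroup.mk_eq_mk_of_mul_inv_mem ⟨i, j, .inr <| .inr <| .inl ⟨h, rfl⟩⟩

theorem ρv_commute {n : ℕ} {i j : Fin (n - 1)} (h : (i : ℕ) + 2 ≤ j) :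
    Commute (ρv n i) (ρv n j) :=
  PresentedGroup.mk_eq_mk_of_mul_inv_mem ⟨i, j, .inr <| .inr <| .inr <| .inl ⟨.inl h, rfl⟩⟩

theorem σv_commute_ρv {n : ℕ} {i j : Fin (n - 1)} (h : (i : ℕ) + 2 ≤ j) :
    Commute (σv n i) (ρv n j) :=
  PresentedGroup.mk_eq_mk_of_mul_inv_mem ⟨i, j, .inr <| .inr <| .inr <| .inr <| .inr <| .inl ⟨.inl h, rfl⟩⟩

/-- For `n ≥ 5`, every homomorphism from `VB n` to a group with commuting commutators has
commutative image. -/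
theorem vb_map_commute {n : ℕ} (hn : 5 ≤ n) {Q : Type*} [Group Q]
    (hQ : ∀ x ∈ commutator Q, ∀ y ∈ commutator Q, Commute x y) (φ : VB n →* Q) (x y : VB n) :
    Commute (φ x) (φ y) := by
  have hσ := braid_family_eq hQ (by omega) (fun i => φ (σv n i))
    (fun i j h => by simpa only [map_mul] using congrArg φ (σv_braid h))
    (fun i j h => (σv_commute h).map φ)
  have hρ := braid_family_eq hQ (by omega) (fun i => φ (ρv n i))
    (fun i j h => by simpa only [map_mul] using congrArg φ (ρv_braid h))
    (fun i j h => (ρv_commute h).map φ)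
  have hσρ (i j : Fin (n - 1)) : Commute (φ (σv n i)) (φ (ρv n j)) := by
    have h := (σv_commute_ρv (n := n) (i := ⟨0, by omega⟩) (j := ⟨2, by omega⟩) le_rfl).map φ
    rwa [hσ _ i, hρ _ j] at h
  have gens (s t : Fin (n - 1) ⊕ Fin (n - 1)) : Commute
      (φ (PresentedGroup.of (rels := vbRels n) s)) (φ (PresentedGroup.of (rels := vbRels n) t)) := by
    rcases s with i | i <;> rcases t with j | j
    · exact hσ i j ▸ Commute.refl (φ (σv n i))
    · exact hσρ i j
    · exact (hσρ j i).symm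
    · exact hρ i j ▸ Commute.refl (φ (ρv n i))
  have hx : x ∈ Subgroup.closure (Set.range (PresentedGroup.of (rels := vbRels n))) := by simp
  have hy : y ∈ Subgroup.closure (Set.range (PresentedGroup.of (rels := vbRels n))) := by simp
  induction hx, hy using Subgroup.closure_induction₂ with
  | mem _ _ hx hy =>
    obtain ⟨s, rfl⟩ := hx
    obtain ⟨t, rfl⟩ := hy
    exact gens s t
  | one_left => simp
  | one_right => simp
  | mul_left _ _ _ _ _ _ h₁ h₂ => rw [map_mul]; exact h₁.mul_left h₂
  | mul_right _ _ _ _ _ _ h₁ h₂ => rw [map_mul]; exact h₁.mul_right h₂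
  | inv_left _ _ _ _ h => rw [map_inv]; exact h.inv_left
  | inv_right _ _ _ _ h => rw [map_inv]; exact h.inv_right

/-- A group modulo the second term of its derived series has commuting commutators. -/
theorem commute_of_mem_commutator_quotient {G : Type*} [Group G]
    {x y : G ⧸ ⁅commutator G, commutator G⁆}
    (hx : x ∈ commutator (G ⧸ ⁅commutator G, commutator G⁆))
    (hy : y ∈ commutator (G ⧸ ⁅commutator G, commutator G⁆)) : Commute x y := by
  have map_eq {H : Type _} [Group H] (f : G →* H) (hf : Function.Surjective f) :
      (commutator G).map f = commutator H := by
    rw [commutator_def, Subgroup.map_commutator, ← MonoidHom.range_eq_map,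
      MonoidHom.range_eq_top.2 hf, commutator_def]
  rw [← map_eq _ (QuotientGroup.mk'_surjective _)] at hx hy
  obtain ⟨x, hx, rfl⟩ := hx
  obtain ⟨y, hy, rfl⟩ := hy
  rw [← commutatorElement_eq_one_iff_commute, ← map_commutatorElement]
  exact (QuotientGroup.eq_one_iff _).2 (Subgroup.commutator_mem_commutator hx hy)

/-- For every `n ≥ 5`, the commutator subgroup `Γ_2(VB_n) = [VB_n, VB_n]`
of the virtual braid group is perfect. -/
theorem vb_commutator_perfect (n : ℕ) (hn : 5 ≤ n) :
    ⁅commutator (VB n), commutator (VB n)⁆ = commutator (VB n) := by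
  refine le_antisymm (Subgroup.commutator_mono le_top le_top) ?_
  refine Subgroup.commutator_le.2 fun x _ y _ => (QuotientGroup.eq_one_iff _).1 ?_
  change QuotientGroup.mk' ⁅commutator (VB n), commutator (VB n)⁆ (x * y * x⁻¹ * y⁻¹) = 1
  rw [← commutatorElement_def, map_commutatorElement, commutatorElement_eq_one_iff_commute]
  exact vb_map_commute hn (fun _ hx _ hy => commute_of_mem_commutator_quotient hx hy) _ x y
end

section
/- For every n ≥ 2, let ϑ : S_n → VB_n be the injective homomorphism sending the transposition (i, i+1) to ρ_i. Then for every permutation π ∈ S_n and all indices 1 ≤ i ≠ j ≤ n, the conjugation identity ϑ(π) x_{i,j} ϑ(π)^{−1} = x_{π(i), π(j)} holds in VB_n. -/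
/-- `σ! n k` is the braid generator of `VB n` with 0-based label `k`
(junk value `1` if `k` is out of range). -/
def σ! (n k : ℕ) : VB n :=
  if h : k < n - 1 then PresentedGroup.of (Sum.inl ⟨k, h⟩) else 1

/-- `ρ! n k` is the virtual generator of `VB n` with 0-based label `k`
(junk value `1` if `k` is out of range). -/
def ρ! (n k : ℕ) : VB n :=
  if h : k < n - 1 then PresentedGroup.of (Sum.inr ⟨k, h⟩) else 1

/-- The ascending product `ρ_{i+1} ρ_{i+2} ⋯ ρ_{j-1}` in `VB n` (0-based labels). -/
def ascProd (n i j : ℕ) : VB n := ((List.range' (i+1) (j-1-i)).map (ρ! n)).prod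

/-- The descending product `ρ_{j-1} ρ_{j-2} ⋯ ρ_{i+1}` in `VB n` (0-based labels). -/
def descProd (n i j : ℕ) : VB n := ((List.range' (i+1) (j-1-i)).reverse.map (ρ! n)).prod

/-- The element `x_{i,j}` of `VB n`, for 0-based strand labels `i ≠ j`:
`x_{i,i+1} = σ_i`, `x_{i,j} = ρ_{j-1} ⋯ ρ_{i+1} σ_i ρ_{i+1} ⋯ ρ_{j-1}` for `i < j`, and
`x_{j,i} = ρ_{j-1} ⋯ ρ_{i+1} (ρ_i σ_i ρ_i) ρ_{i+1} ⋯ ρ_{j-1}` for `i < j`. -/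
def xV (n i j : ℕ) : VB n :=
  if i < j then descProd n i j * σ! n i * ascProd n i j
  else descProd n j i * (ρ! n j * σ! n j * ρ! n j) * ascProd n j i

section Relations

variable {n : ℕ}

theorem vb_eq_of_relator {a b : FreeGroup (Fin (n - 1) ⊕ Fin (n - 1))}
    (h : a * b⁻¹ ∈ vbRels n) :
    PresentedGroup.mk (vbRels n) a = PresentedGroup.mk (vbRels n) b := by
  rw [← mul_inv_eq_one, ← map_inv, ← map_mul]
  exact PresentedGroup.mk_eq_one_iff.mpr (Subgroup.subset_normalClosure h)

theorem ρ!_mul_self (k : ℕ) : ρ! n k * ρ! n k = 1 := by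
  unfold ρ!
  split_ifs with h
  · exact PresentedGroup.one_of_mem (rels := vbRels n) (x := ρg n ⟨k, h⟩ * ρg n ⟨k, h⟩)
      ⟨⟨k, h⟩, ⟨k, h⟩, by simp⟩
  · simp

theorem ρ!_commute {i j : ℕ} (hij : i + 2 ≤ j ∨ j + 2 ≤ i) : Commute (ρ! n i) (ρ! n j) := by
  unfold ρ!
  split_ifs with hi hj
  · exact vb_eq_of_relator (a := ρg n ⟨i, hi⟩ * ρg n ⟨j, hj⟩) (b := ρg n ⟨j, hj⟩ * ρg n ⟨i, hi⟩)
      ⟨⟨i, hi⟩, ⟨j, hj⟩, Or.inr (Or.inr (Or.inr (Or.inl ⟨hij, rfl⟩)))⟩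
  all_goals simp

theorem ρ!_commute_σ! {i j : ℕ} (hij : i + 2 ≤ j ∨ j + 2 ≤ i) :
    Commute (ρ! n j) (σ! n i) := by
  unfold ρ! σ!
  split_ifs with hj hi
  · exact (vb_eq_of_relator (a := σg n ⟨i, hi⟩ * ρg n ⟨j, hj⟩)
      (b := ρg n ⟨j, hj⟩ * σg n ⟨i, hi⟩)
      ⟨⟨i, hi⟩, ⟨j, hj⟩, Or.inr (Or.inr (Or.inr (Or.inr (Or.inr (Or.inl ⟨hij, rfl⟩)))))⟩).symm
  all_goals simp

theorem ρ!_braid {k : ℕ} (hk : k + 2 < n) :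
    ρ! n k * ρ! n (k + 1) * ρ! n k = ρ! n (k + 1) * ρ! n k * ρ! n (k + 1) := by
  have h₀ : k < n - 1 := by omega
  have h₁ : k + 1 < n - 1 := by omega
  simp only [ρ!, dif_pos h₀, dif_pos h₁]
  exact vb_eq_of_relator (a := ρg n ⟨k, h₀⟩ * ρg n ⟨k + 1, h₁⟩ * ρg n ⟨k, h₀⟩)
    (b := ρg n ⟨k + 1, h₁⟩ * ρg n ⟨k, h₀⟩ * ρg n ⟨k + 1, h₁⟩)
    ⟨⟨k, h₀⟩, ⟨k + 1, h₁⟩, Or.inr (Or.inr (Or.inl ⟨rfl, rfl⟩))⟩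

theorem ρ!_mul_ρ!_semiconjBy_σ! {k : ℕ} (hk : k + 2 < n) :
    SemiconjBy (ρ! n k * ρ! n (k + 1)) (σ! n k) (σ! n (k + 1)) := by
  have h₀ : k < n - 1 := by omega
  have h₁ : k + 1 < n - 1 := by omega
  simp only [SemiconjBy, ρ!, σ!, dif_pos h₀, dif_pos h₁, ← mul_assoc]
  exact vb_eq_of_relator (a := ρg n ⟨k, h₀⟩ * ρg n ⟨k + 1, h₁⟩ * σg n ⟨k, h₀⟩)
    (b := σg n ⟨k + 1, h₁⟩ * ρg n ⟨k, h₀⟩ * ρg n ⟨k + 1, h₁⟩)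
    ⟨⟨k, h₀⟩, ⟨k + 1, h₁⟩, Or.inr (Or.inr (Or.inr (Or.inr (Or.inr (Or.inr ⟨rfl, rfl⟩)))))⟩

theorem ρ!_semiconjBy_conj (k : ℕ) (y : VB n) : SemiconjBy (ρ! n k) y (ρ! n k * y * ρ! n k) := by
  simp [SemiconjBy, mul_assoc, ρ!_mul_self]

theorem ρ!_semiconjBy_symm {k : ℕ} {y z : VB n} (h : SemiconjBy (ρ! n k) y z) :
    SemiconjBy (ρ! n k) z y := by
  have hinv : (ρ! n k)⁻¹ = ρ! n k := inv_eq_of_mul_eq_one_left (ρ!_mul_self k)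
  simpa [hinv] using h.inv_symm_left

end Relations

theorem SemiconjBy.transport {G : Type*} [Group G] {a r y z y' z' : G} (hc : Commute r a)
    (hy : SemiconjBy a y y') (hz : SemiconjBy a z z') (h : SemiconjBy r y z) :
    SemiconjBy r y' z' := by
  have key := (hz.mul_left h).mul_left hy.inv_symm_left
  rwa [← hc.eq, mul_inv_cancel_right] at key

/-- A family `t` of elements of `VB n` that the virtual generators permute in the way they
permute the braid generators. -/
structure IsBraidLike (n : ℕ) (t : ℕ → VB n) : Prop where
  commute : ∀ i j, i + 2 ≤ j ∨ j + 2 ≤ i → Commute (ρ! n j) (t i)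
  semiconj : ∀ i, i + 2 < n → SemiconjBy (ρ! n i * ρ! n (i + 1)) (t i) (t (i + 1))

theorem isBraidLike_σ! (n : ℕ) : IsBraidLike n (σ! n) :=
  ⟨fun _ _ h => ρ!_commute_σ! h, fun _ h => ρ!_mul_ρ!_semiconjBy_σ! h⟩

theorem isBraidLike_ρ!_conj (n : ℕ) : IsBraidLike n (fun i => ρ! n i * σ! n i * ρ! n i) where
  commute i j h := by
    have hρ : Commute (ρ! n j) (ρ! n i) := ρ!_commute h.symm
    exact (hρ.mul_right (ρ!_commute_σ! h)).mul_right hρ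
  semiconj i h := by
    have key := (ρ!_semiconjBy_conj (i + 1) (σ! n (i + 1))).mul_left (ρ!_mul_ρ!_semiconjBy_σ! h)
    have := key.mul_left (ρ!_semiconjBy_symm (ρ!_semiconjBy_conj i (σ! n i)))
    rwa [← mul_assoc, ← ρ!_braid h, mul_assoc, ρ!_mul_self, mul_one] at this

/-- The conjugate `ρ_{j-1} ⋯ ρ_{i+1} t_i ρ_{i+1} ⋯ ρ_{j-1}`. -/
def chainConj (n : ℕ) (t : ℕ → VB n) (i j : ℕ) : VB n := descProd n i j * t i * ascProd n i j

section ChainConj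

variable {n : ℕ} {t : ℕ → VB n}

theorem chainConj_succ_self (t : ℕ → VB n) (i : ℕ) : chainConj n t i (i + 1) = t i := by
  simp [chainConj, descProd, ascProd]

theorem chainConj_step (t : ℕ → VB n) {i j : ℕ} (hij : i < j) :
    SemiconjBy (ρ! n j) (chainConj n t i j) (chainConj n t i (j + 1)) := by
  have hlen : j + 1 - 1 - i = (j - 1 - i) + 1 := by omega
  have hlast : i + 1 + (j - 1 - i) = j := by omega
  have h : chainConj n t i (j + 1) = ρ! n j * chainConj n t i j * ρ! n j := by
    rw [chainConj, descProd, ascProd, hlen, List.range'_concat, one_mul, hlast]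
    simp [chainConj, descProd, ascProd, mul_assoc]
  rw [h]
  exact ρ!_semiconjBy_conj j _

namespace IsBraidLike

theorem chainConj_commute_of_disjoint (ht : IsBraidLike n t) {i j k : ℕ} (hij : i < j)
    (hk : k + 1 < i ∨ j < k) : Commute (ρ! n k) (chainConj n t i j) := by
  induction j, Nat.succ_le_of_lt hij using Nat.le_induction with
  | base =>
    rw [Nat.succ_eq_add_one, chainConj_succ_self]
    exact ht.commute i k (by omega)
  | succ j hj ih =>
    have hs := chainConj_step t (Nat.lt_of_succ_le hj)
    exact SemiconjBy.transport (ρ!_commute (by omega)) hs hs (ih hj (by omega))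

theorem chainConj_semiconj_left (ht : IsBraidLike n t) {j k : ℕ} (hkj : k + 2 ≤ j) (hj : j < n) :
    SemiconjBy (ρ! n k) (chainConj n t (k + 1) j) (chainConj n t k j) := by
  induction j, hkj using Nat.le_induction with
  | base =>
    rw [chainConj_succ_self]
    have hs := chainConj_step t k.lt_succ_self
    rw [chainConj_succ_self] at hs
    have h := (ht.semiconj k hj).mul_left (ρ!_semiconjBy_symm hs)
    rw [mul_assoc, ρ!_mul_self, mul_one] at h
    exact ρ!_semiconjBy_symm h
  | succ j hkj ih =>
    exact SemiconjBy.transport (ρ!_commute (by omega)) (chainConj_step t (by omega))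
      (chainConj_step t (by omega)) (ih (by omega))

theorem chainConj_commute_of_between (ht : IsBraidLike n t) {i j k : ℕ} (hik : i < k)
    (hkj : k + 2 ≤ j) (hj : j < n) : Commute (ρ! n k) (chainConj n t i j) := by
  induction j, hkj using Nat.le_induction with
  | base =>
    have hs := (chainConj_step t (hik.trans k.lt_succ_self)).mul_left (chainConj_step t hik)
    have h := hs.mul_left (ht.chainConj_commute_of_disjoint hik (Or.inr k.lt_succ_self))
    rw [Nat.succ_eq_add_one, ← ρ!_braid hj, mul_assoc] at h
    have := h.mul_left hs.inv_symm_left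
    rwa [mul_inv_cancel_right] at this
  | succ j hkj ih =>
    have hs := chainConj_step t (show i < j by omega)
    exact SemiconjBy.transport (ρ!_commute (by omega)) hs hs (ih (by omega))

theorem chainConj_semiconj_swap (ht : IsBraidLike n t) {i j k : ℕ} (hij : i < j) (hj : j < n)
    (hk : k + 1 < n) (hne : ¬(k = i ∧ k + 1 = j)) :
    SemiconjBy (ρ! n k) (chainConj n t i j)
      (chainConj n t (Equiv.swap k (k + 1) i) (Equiv.swap k (k + 1) j)) := by
  rcases lt_trichotomy k i with hki | rfl | hki
  · rw [Equiv.swap_apply_of_ne_of_ne (by omega : j ≠ k) (by omega)]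
    obtain rfl | h := eq_or_ne i (k + 1)
    · rw [Equiv.swap_apply_right]
      exact ht.chainConj_semiconj_left hij hj
    · rw [Equiv.swap_apply_of_ne_of_ne (by omega) h]
      exact ht.chainConj_commute_of_disjoint hij (by omega)
  · rw [Equiv.swap_apply_left, Equiv.swap_apply_of_ne_of_ne (by omega : j ≠ k) (by omega)]
    exact ρ!_semiconjBy_symm (ht.chainConj_semiconj_left (by omega) hj)
  · rw [Equiv.swap_apply_of_ne_of_ne (by omega : i ≠ k) (by omega)]
    obtain rfl | h := eq_or_ne j k
    · rw [Equiv.swap_apply_left]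
      exact chainConj_step t hij
    obtain rfl | h' := eq_or_ne j (k + 1)
    · rw [Equiv.swap_apply_right]
      exact ρ!_semiconjBy_symm (chainConj_step t hki)
    rw [Equiv.swap_apply_of_ne_of_ne h h']
    rcases lt_or_gt_of_ne h with h | h
    · exact ht.chainConj_commute_of_disjoint hij (Or.inr h)
    · exact ht.chainConj_commute_of_between hki (by omega) hj

end IsBraidLike

end ChainConj

theorem xV_of_lt (n : ℕ) {i j : ℕ} (h : i < j) : xV n i j = chainConj n (σ! n) i j := if_pos h

theorem xV_of_gt (n : ℕ) {i j : ℕ} (h : j < i) :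
    xV n i j = chainConj n (fun l => ρ! n l * σ! n l * ρ! n l) j i := if_neg h.not_gt

theorem swap_succ_lt_swap_succ {i j k : ℕ} (hij : i < j) (hne : ¬(k = i ∧ k + 1 = j)) :
    Equiv.swap k (k + 1) i < Equiv.swap k (k + 1) j := by
  simp only [Equiv.swap_apply_def]
  split_ifs <;> omega

theorem ρ!_semiconjBy_xV {n i j k : ℕ} (hi : i < n) (hj : j < n) (hk : k + 1 < n) (hij : i ≠ j) :
    SemiconjBy (ρ! n k) (xV n i j)
      (xV n (Equiv.swap k (k + 1) i) (Equiv.swap k (k + 1) j)) := by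
  have adjacent : SemiconjBy (ρ! n k) (xV n k (k + 1)) (xV n (k + 1) k) := by
    rw [xV_of_lt n k.lt_succ_self, xV_of_gt n k.lt_succ_self, chainConj_succ_self,
      chainConj_succ_self]
    exact ρ!_semiconjBy_conj k _
  rcases lt_or_gt_of_ne hij with h | h
  · by_cases hc : k = i ∧ k + 1 = j
    · obtain ⟨rfl, rfl⟩ := hc
      simpa using adjacent
    · rw [xV_of_lt n h, xV_of_lt n (swap_succ_lt_swap_succ h hc)]
      exact (isBraidLike_σ! n).chainConj_semiconj_swap h hj hk hc
  · by_cases hc : k = j ∧ k + 1 = i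
    · obtain ⟨rfl, rfl⟩ := hc
      simpa using ρ!_semiconjBy_symm adjacent
    · rw [xV_of_gt n h, xV_of_gt n (swap_succ_lt_swap_succ h hc)]
      exact (isBraidLike_ρ!_conj n).chainConj_semiconj_swap h hi hk hc

theorem coe_sw_apply (n : ℕ) (k : Fin (n - 1)) (i : Fin n) :
    (sw n k i : ℕ) = Equiv.swap (k : ℕ) (k + 1) i := by
  simp only [sw, Equiv.swap_apply_def, Fin.ext_iff]
  split_ifs <;> rfl

theorem mclosure_range_sw {n : ℕ} (hn : 1 ≤ n) : Submonoid.closure (Set.range (sw n)) = ⊤ := by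
  obtain ⟨m, rfl⟩ := Nat.exists_eq_add_of_le' hn
  exact Equiv.Perm.mclosure_swap_castSucc_succ m

/-- Let `ϑ : S_n → VB_n` be the injective homomorphism sending the
transposition `(i, i+1)` to `ρ_i`. For every permutation `π ∈ S_n` and all `i ≠ j`, the
conjugation identity `ϑ(π) x_{i,j} ϑ(π)⁻¹ = x_{π(i), π(j)}` holds in `VB_n`. -/
theorem perm_conj_x (n : ℕ) (hn : 2 ≤ n) (ϑ : Equiv.Perm (Fin n) →* VB n)
    (hϑ : ∀ i : Fin (n-1), ϑ (sw n i) = ρv n i) (hinj : Function.Injective ϑ)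
    (π : Equiv.Perm (Fin n)) (i j : Fin n) (hij : i ≠ j) :
    ϑ π * xV n i j * (ϑ π)⁻¹ = xV n (π i) (π j) := by
  have hπ : π ∈ Submonoid.closure (Set.range (sw n)) := by
    rw [mclosure_range_sw (by omega)]
    trivial
  have key : SemiconjBy (ϑ π) (xV n i j) (xV n (π i) (π j)) := by
    induction hπ using Submonoid.closure_induction generalizing i j with
    | mem _ h =>
      obtain ⟨k, rfl⟩ := h
      have hρ : ϑ (sw n k) = ρ! n k := by rw [hϑ, ρ!, dif_pos k.isLt]; rfl
      rw [hρ, coe_sw_apply, coe_sw_apply]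
      exact ρ!_semiconjBy_xV i.isLt j.isLt (by omega) (Fin.val_ne_of_ne hij)
    | one => simp
    | mul π₁ π₂ _ _ ih₁ ih₂ =>
      rw [map_mul]
      exact (ih₁ _ _ (π₂.injective.ne hij)).mul_left (ih₂ i j hij)
  rw [key.eq, mul_inv_cancel_right]
end

section
/- For every n ≥ 2, the group H_n (the kernel of μ : VB_n → S_n, equivalently the normal closure of B_n in VB_n) is isomorphic to the group K_n given by the presentation with generators x_{k,l} for 1 ≤ k ≠ l ≤ n and defining relations x_{i,j} x_{k,l} = x_{k,l} x_{i,j} for pairwise distinct indices i, j, k, l, and x_{i,k} x_{k,j} x_{i,k} = x_{k,j} x_{i,k} x_{k,j} for pairwise distinct indices i, j, k; the isomorphism sends the generator x_{k,l} of K_n to the element x_{k,l} of VB_n. -/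
/-- Index type for the generators `x_{k,l}`, `1 ≤ k ≠ l ≤ n`, of the group `K_n ≅ H_n`. -/
def KGenIdx (n : ℕ) : Type := {p : Fin n × Fin n // p.1 ≠ p.2}

/-- The free-group letter `x_{i,j}` (equal to the junk value `1` when `i = j`). -/
def Xg (n : ℕ) (i j : Fin n) : FreeGroup (KGenIdx n) :=
  if h : i = j then 1 else FreeGroup.of ⟨(i, j), h⟩

/-- The defining relators of `K_n`: `x_{i,j} x_{k,l} = x_{k,l} x_{i,j}` for pairwise distinct
`i, j, k, l`, and `x_{i,k} x_{k,j} x_{i,k} = x_{k,j} x_{i,k} x_{k,j}` for pairwise distinct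
`i, j, k`. -/
def KRels (n : ℕ) : Set (FreeGroup (KGenIdx n)) :=
  {r | (∃ i j k l : Fin n, i ≠ j ∧ k ≠ l ∧ i ≠ k ∧ i ≠ l ∧ j ≠ k ∧ j ≠ l ∧
          r = Xg n i j * Xg n k l * (Xg n k l * Xg n i j)⁻¹) ∨
       (∃ i j k : Fin n, i ≠ j ∧ k ≠ i ∧ k ≠ j ∧
          r = Xg n i k * Xg n k j * Xg n i k * (Xg n k j * Xg n i k * Xg n k j)⁻¹)}

/-- The group `K_n`, abstractly presented; it is isomorphic to `H_n = ker μ`. -/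
abbrev K (n : ℕ) : Type := PresentedGroup (KRels n)

open PresentedGroup in
theorem rho_mul_self (n k : ℕ) : ρ! n k * ρ! n k = 1 := by
  unfold ρ!
  split_ifs with h
  · refine one_of_mem (x := ρg n ⟨k, h⟩ * ρg n ⟨k, h⟩) ⟨⟨k, h⟩, ⟨k, h⟩, ?_⟩
    simp
  · simp

theorem rho_inv (n k : ℕ) : (ρ! n k)⁻¹ = ρ! n k :=
  inv_eq_of_mul_eq_one_left (rho_mul_self n k)

open PresentedGroup in
theorem rho_comm {n i j : ℕ} (hij : i + 2 ≤ j) : ρ! n i * ρ! n j = ρ! n j * ρ! n i := by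
  unfold ρ!
  split_ifs with h h'
  · refine mk_eq_mk_of_mul_inv_mem (x := ρg n ⟨i, h⟩ * ρg n ⟨j, h'⟩)
      (y := ρg n ⟨j, h'⟩ * ρg n ⟨i, h⟩) ⟨⟨i, h⟩, ⟨j, h'⟩, ?_⟩
    simp [hij]
  all_goals simp

open PresentedGroup in
theorem rho_braid {n i : ℕ} (hi : i + 1 < n - 1) :
    ρ! n i * ρ! n (i + 1) * ρ! n i = ρ! n (i + 1) * ρ! n i * ρ! n (i + 1) := by
  have h : i < n - 1 := by omega
  simp only [ρ!, h, hi, dif_pos]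
  refine mk_eq_mk_of_mul_inv_mem (x := ρg n ⟨i, h⟩ * ρg n ⟨i + 1, hi⟩ * ρg n ⟨i, h⟩)
    (y := ρg n ⟨i + 1, hi⟩ * ρg n ⟨i, h⟩ * ρg n ⟨i + 1, hi⟩) ⟨⟨i, h⟩, ⟨i + 1, hi⟩, ?_⟩
  simp

open PresentedGroup in
theorem sigma_rho_comm {n i j : ℕ} (hij : i + 2 ≤ j) : σ! n i * ρ! n j = ρ! n j * σ! n i := by
  unfold σ! ρ!
  split_ifs with h h'
  · refine mk_eq_mk_of_mul_inv_mem (x := σg n ⟨i, h⟩ * ρg n ⟨j, h'⟩)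
      (y := ρg n ⟨j, h'⟩ * σg n ⟨i, h⟩) ⟨⟨i, h⟩, ⟨j, h'⟩, ?_⟩
    simp [hij]
  all_goals simp

open PresentedGroup in
theorem sigma_comm {n i j : ℕ} (hij : i + 2 ≤ j) : σ! n i * σ! n j = σ! n j * σ! n i := by
  unfold σ!
  split_ifs with h h'
  · refine mk_eq_mk_of_mul_inv_mem (x := σg n ⟨i, h⟩ * σg n ⟨j, h'⟩)
      (y := σg n ⟨j, h'⟩ * σg n ⟨i, h⟩) ⟨⟨i, h⟩, ⟨j, h'⟩, ?_⟩
    simp [hij]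
  all_goals simp

open PresentedGroup in
theorem sigma_braid {n i : ℕ} (hi : i + 1 < n - 1) :
    σ! n i * σ! n (i + 1) * σ! n i = σ! n (i + 1) * σ! n i * σ! n (i + 1) := by
  have h : i < n - 1 := by omega
  simp only [σ!, h, hi, dif_pos]
  refine mk_eq_mk_of_mul_inv_mem (x := σg n ⟨i, h⟩ * σg n ⟨i + 1, hi⟩ * σg n ⟨i, h⟩)
    (y := σg n ⟨i + 1, hi⟩ * σg n ⟨i, h⟩ * σg n ⟨i + 1, hi⟩) ⟨⟨i, h⟩, ⟨i + 1, hi⟩, ?_⟩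
  simp

open PresentedGroup in
theorem rho_rho_sigma {n i : ℕ} (hi : i + 1 < n - 1) :
    ρ! n i * ρ! n (i + 1) * σ! n i = σ! n (i + 1) * ρ! n i * ρ! n (i + 1) := by
  have h : i < n - 1 := by omega
  simp only [ρ!, σ!, h, hi, dif_pos]
  refine mk_eq_mk_of_mul_inv_mem (x := ρg n ⟨i, h⟩ * ρg n ⟨i + 1, hi⟩ * σg n ⟨i, h⟩)
    (y := σg n ⟨i + 1, hi⟩ * ρg n ⟨i, h⟩ * ρg n ⟨i + 1, hi⟩) ⟨⟨i, h⟩, ⟨i + 1, hi⟩, ?_⟩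
  simp

/-- The subgroup of `VB n` generated by the `ρ_k` with (0-based) label `k ≥ m`. -/
def rhoSubgroup (n m : ℕ) : Subgroup (VB n) :=
  Subgroup.closure {g | ∃ k, m ≤ k ∧ g = ρ! n k}

theorem rho_mem_rhoSubgroup {n m k : ℕ} (h : m ≤ k) : ρ! n k ∈ rhoSubgroup n m :=
  Subgroup.subset_closure ⟨k, h, rfl⟩

theorem rhoSubgroup_eq_bot {n m : ℕ} (h : n - 1 ≤ m) : rhoSubgroup n m = ⊥ := by
  rw [rhoSubgroup, Subgroup.closure_eq_bot_iff]
  rintro _ ⟨k, hk, rfl⟩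
  have : ¬ k < n - 1 := by omega
  simp [ρ!, this]

theorem rhoSubgroup_induction {n m : ℕ} {p : ∀ g, g ∈ rhoSubgroup n m → Prop}
    (one : p 1 (one_mem _))
    (mul : ∀ k g (hk : m ≤ k), k < n - 1 → ∀ hg : g ∈ rhoSubgroup n m, p g hg →
      p (ρ! n k * g) (mul_mem (rho_mem_rhoSubgroup hk) hg))
    {g : VB n} (hg : g ∈ rhoSubgroup n m) : p g hg := by
  have step : ∀ k g (hk : m ≤ k) (hg : g ∈ rhoSubgroup n m), p g hg →
      p (ρ! n k * g) (mul_mem (rho_mem_rhoSubgroup hk) hg) := by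
    intro k g hk hg h
    by_cases hk' : k < n - 1
    · exact mul k g hk hk' hg h
    · simpa [ρ!, hk'] using h
  induction hg using Subgroup.closure_induction_left with
  | one => exact one
  | mul_left x hx y hy ih =>
    obtain ⟨k, hk, rfl⟩ := hx
    exact step k y hk hy ih
  | inv_mul_cancel x hx y hy ih =>
    obtain ⟨k, hk, rfl⟩ := hx
    simpa only [rho_inv] using step k y hk hy ih

/-- The product `ρ_{m+t-1} ⋯ ρ_{m+1} ρ_m` in `VB n` (0-based labels). -/
def rhoDesc (n m : ℕ) : ℕ → VB n
  | 0 => 1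
  | t + 1 => ρ! n (m + t) * rhoDesc n m t

theorem rhoDesc_mem (n m t : ℕ) : rhoDesc n m t ∈ rhoSubgroup n m := by
  induction t with
  | zero => exact one_mem _
  | succ t ih => exact mul_mem (rho_mem_rhoSubgroup (by omega)) ih

theorem rho_mul_rhoDesc_of_lt {n m t j : ℕ} (h : m + t + 1 ≤ j) :
    ρ! n j * rhoDesc n m t = rhoDesc n m t * ρ! n j := by
  induction t with
  | zero => simp [rhoDesc]
  | succ t ih =>
    rw [rhoDesc, ← mul_assoc, ← rho_comm (by omega), mul_assoc, ih (by omega), mul_assoc]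

theorem rho_mul_rhoDesc_of_gt {n m t j : ℕ} (hm : m ≤ j) (hj : j + 2 ≤ m + t)
    (ht : m + t ≤ n - 1) :
    ρ! n j * rhoDesc n m t = rhoDesc n m t * ρ! n (j + 1) := by
  induction t with
  | zero => omega
  | succ t ih =>
    by_cases h : j + 2 ≤ m + t
    · rw [rhoDesc, ← mul_assoc, rho_comm (by omega), mul_assoc, ih h (by omega), mul_assoc]
    · obtain ⟨s, rfl⟩ : ∃ s, t = s + 1 := ⟨t - 1, by omega⟩
      obtain rfl : j = m + s := by omega
      have hb := rho_braid (n := n) (i := m + s) (by omega)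
      rw [rhoDesc, rhoDesc, ← add_assoc, ← mul_assoc, ← mul_assoc, hb, mul_assoc, mul_assoc,
        rho_mul_rhoDesc_of_lt (by omega)]
      simp only [mul_assoc]

theorem exists_eq_rhoDesc_mul {n m : ℕ} (hm : m ≤ n - 1) {g : VB n} (hg : g ∈ rhoSubgroup n m) :
    ∃ t, m + t ≤ n - 1 ∧ ∃ r ∈ rhoSubgroup n (m + 1), g = rhoDesc n m t * r := by
  induction hg using rhoSubgroup_induction with
  | one => exact ⟨0, by omega, 1, one_mem _, by simp [rhoDesc]⟩
  | mul j g hj hjn _ ih =>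
    obtain ⟨t, ht, r, hr, rfl⟩ := ih
    rcases lt_trichotomy j (m + t) with h | h | h
    · by_cases h' : j + 2 ≤ m + t
      · refine ⟨t, ht, ρ! n (j + 1) * r, mul_mem (rho_mem_rhoSubgroup (by omega)) hr, ?_⟩
        rw [← mul_assoc, rho_mul_rhoDesc_of_gt hj h' ht, mul_assoc]
      · obtain ⟨s, rfl⟩ : ∃ s, t = s + 1 := ⟨t - 1, by omega⟩
        obtain rfl : j = m + s := by omega
        refine ⟨s, by omega, r, hr, ?_⟩
        rw [rhoDesc, ← mul_assoc, ← mul_assoc, rho_mul_self, one_mul]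
    · subst h
      exact ⟨t + 1, by omega, r, hr, by rw [rhoDesc, mul_assoc]⟩
    · refine ⟨t, ht, ρ! n j * r, mul_mem (rho_mem_rhoSubgroup (by omega)) hr, ?_⟩
      rw [← mul_assoc, rho_mul_rhoDesc_of_lt (by omega), mul_assoc]

section Action

variable {n : ℕ} {μ : VB n →* Equiv.Perm (Fin n)}

theorem IsMu.map_rho (hμ : IsMu n μ) {k : ℕ} (hk : k < n - 1) :
    μ (ρ! n k) = Equiv.swap ⟨k, by omega⟩ ⟨k + 1, by omega⟩ := by
  have := (hμ ⟨k, hk⟩).2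
  simpa [ρ!, hk, ρv, sw] using this

theorem IsMu.map_sigma (hμ : IsMu n μ) (k : ℕ) : μ (σ! n k) = 1 := by
  by_cases hk : k < n - 1
  · simpa [σ!, hk, σv] using (hμ ⟨k, hk⟩).1
  · simp [σ!, hk]

theorem IsMu.map_rho_apply_of_lt (hμ : IsMu n μ) {k : ℕ} {a : Fin n} (h : a.1 < k) :
    μ (ρ! n k) a = a := by
  by_cases hk : k < n - 1
  · rw [hμ.map_rho hk, Equiv.swap_apply_of_ne_of_ne] <;> simp [Fin.ext_iff] <;> omega
  · simp [ρ!, hk]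

theorem IsMu.map_apply_of_mem (hμ : IsMu n μ) {m : ℕ} {g : VB n} (hg : g ∈ rhoSubgroup n m)
    {a : Fin n} (h : a.1 < m) : μ g a = a := by
  induction hg using rhoSubgroup_induction with
  | one => simp
  | mul k g hk _ _ ih =>
    rw [map_mul, Equiv.Perm.mul_apply, ih, hμ.map_rho_apply_of_lt (by omega)]

theorem IsMu.map_rhoDesc_apply (hμ : IsMu n μ) {m t : ℕ} (h : m + t < n) :
    μ (rhoDesc n m t) ⟨m, by omega⟩ = ⟨m + t, h⟩ := by
  induction t with
  | zero => simp [rhoDesc]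
  | succ t ih =>
    rw [rhoDesc, map_mul, Equiv.Perm.mul_apply, ih (by omega), hμ.map_rho (by omega),
      Equiv.swap_apply_left]
    rfl

theorem IsMu.mem_rhoSubgroup_succ (hμ : IsMu n μ) {m : ℕ} (hm : m < n) {g : VB n}
    (hg : g ∈ rhoSubgroup n m) (h : μ g ⟨m, hm⟩ = ⟨m, hm⟩) : g ∈ rhoSubgroup n (m + 1) := by
  obtain ⟨t, ht, r, hr, rfl⟩ := exists_eq_rhoDesc_mul (by omega) hg
  rw [map_mul, Equiv.Perm.mul_apply, hμ.map_apply_of_mem hr (by simp),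
    hμ.map_rhoDesc_apply (by omega), Fin.mk.injEq] at h
  obtain rfl : t = 0 := by omega
  simpa [rhoDesc] using hr

theorem IsMu.eq_one_of_mem (hμ : IsMu n μ) {g : VB n} (hg : g ∈ rhoSubgroup n 0)
    (h : μ g = 1) : g = 1 := by
  have key : ∀ m, m ≤ n → g ∈ rhoSubgroup n m := by
    intro m
    induction m with
    | zero => exact fun _ => hg
    | succ m ih => exact fun hm => hμ.mem_rhoSubgroup_succ (by omega) (ih (by omega)) (by simp [h])
  simpa [rhoSubgroup_eq_bot (Nat.sub_le n 1)] using key n le_rfl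

theorem commute_sigma_zero {g : VB n} (hg : g ∈ rhoSubgroup n 2) :
    g * σ! n 0 = σ! n 0 * g := by
  induction hg using rhoSubgroup_induction with
  | one => simp
  | mul k g hk _ _ ih =>
    rw [mul_assoc, ih, ← mul_assoc, ← mul_assoc, sigma_rho_comm (by omega)]

theorem IsMu.conj_sigma_zero_eq (hμ : IsMu n μ) (hn : 2 ≤ n) {r s : VB n}
    (hr : r ∈ rhoSubgroup n 0) (hs : s ∈ rhoSubgroup n 0)
    (h0 : μ r ⟨0, by omega⟩ = μ s ⟨0, by omega⟩)
    (h1 : μ r ⟨1, by omega⟩ = μ s ⟨1, by omega⟩) :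
    r * σ! n 0 * r⁻¹ = s * σ! n 0 * s⁻¹ := by
  have hmem : s⁻¹ * r ∈ rhoSubgroup n 0 := mul_mem (inv_mem hs) hr
  have h1' := hμ.mem_rhoSubgroup_succ (m := 0) (by omega) hmem (by simp [h0])
  have h2' := hμ.mem_rhoSubgroup_succ (m := 1) (by omega) h1' (by simp [h1])
  have hc := commute_sigma_zero h2'
  rw [mul_assoc, inv_mul_eq_iff_eq_mul] at hc
  rw [hc]
  group

theorem descProd_eq_rhoDesc {i j : ℕ} : descProd n i j = rhoDesc n (i + 1) (j - 1 - i) := by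
  unfold descProd
  induction j - 1 - i with
  | zero => simp [rhoDesc]
  | succ t ih => rw [List.range'_concat]; simp [rhoDesc, ← ih]

theorem ascProd_eq_inv (i j : ℕ) : ascProd n i j = (descProd n i j)⁻¹ := by
  simp [ascProd, descProd, List.prod_inv_reverse, Function.comp_def, rho_inv]

theorem IsMu.exists_conj_sigma (hμ : IsMu n μ) {i : ℕ} (hi : i + 1 < n) :
    ∃ r ∈ rhoSubgroup n 0, μ r ⟨0, by omega⟩ = ⟨i, by omega⟩ ∧
      μ r ⟨1, by omega⟩ = ⟨i + 1, hi⟩ ∧ r * σ! n 0 * r⁻¹ = σ! n i := by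
  induction i with
  | zero => exact ⟨1, one_mem _, by simp⟩
  | succ i ih =>
    obtain ⟨r, hr, h0, h1, h⟩ := ih (by omega)
    refine ⟨ρ! n i * ρ! n (i + 1) * r, mul_mem (mul_mem (rho_mem_rhoSubgroup (by omega))
      (rho_mem_rhoSubgroup (by omega))) hr, ?_, ?_, ?_⟩
    · rw [map_mul, map_mul, Equiv.Perm.mul_apply, Equiv.Perm.mul_apply, h0,
        hμ.map_rho_apply_of_lt (k := i + 1) (by simp), hμ.map_rho (by omega),
        Equiv.swap_apply_left]
    · rw [map_mul, map_mul, Equiv.Perm.mul_apply, Equiv.Perm.mul_apply, h1,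
        hμ.map_rho (k := i + 1) (by omega), Equiv.swap_apply_left, hμ.map_rho (by omega),
        Equiv.swap_apply_of_ne_of_ne] <;> simp only [ne_eq, Fin.mk.injEq] <;> omega
    · calc _ = (ρ! n i * ρ! n (i + 1)) * (r * σ! n 0 * r⁻¹) * (ρ! n i * ρ! n (i + 1))⁻¹ := by group
        _ = _ := by rw [h, rho_rho_sigma (by omega)]; group

theorem IsMu.exists_conj_xV (hμ : IsMu n μ) (hn : 2 ≤ n) {i j : Fin n} (hij : i ≠ j) :
    ∃ r ∈ rhoSubgroup n 0, μ r ⟨0, by omega⟩ = i ∧ μ r ⟨1, by omega⟩ = j ∧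
      r * σ! n 0 * r⁻¹ = xV n i j := by
  have hdesc (a b : ℕ) : descProd n a b ∈ rhoSubgroup n (a + 1) := by
    rw [descProd_eq_rhoDesc]; exact rhoDesc_mem _ _ _
  have hle (a : ℕ) : rhoSubgroup n a ≤ rhoSubgroup n 0 :=
    Subgroup.closure_mono fun _ ⟨k, _, hk⟩ => ⟨k, Nat.zero_le k, hk⟩
  have happ {a b : ℕ} (hab : a < b) (hb : b < n) :
      μ (descProd n a b) ⟨a + 1, by omega⟩ = ⟨b, hb⟩ := by
    rw [descProd_eq_rhoDesc, hμ.map_rhoDesc_apply (by omega), Fin.mk.injEq]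
    omega
  obtain ⟨i, hi⟩ := i
  obtain ⟨j, hj⟩ := j
  rw [Ne, Fin.mk.injEq] at hij
  rcases lt_or_gt_of_ne hij with h | h
  · obtain ⟨r, hr, h0, h1, hc⟩ := hμ.exists_conj_sigma (i := i) (by omega)
    refine ⟨descProd n i j * r, mul_mem (hle _ (hdesc i j)) hr, ?_, ?_, ?_⟩
    · rw [map_mul, Equiv.Perm.mul_apply, h0, hμ.map_apply_of_mem (hdesc i j) (by simp)]
    · rw [map_mul, Equiv.Perm.mul_apply, h1, happ h hj]
    · rw [xV, if_pos h, ascProd_eq_inv, ← hc]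
      group
  · obtain ⟨r, hr, h0, h1, hc⟩ := hμ.exists_conj_sigma (i := j) (by omega)
    refine ⟨descProd n j i * ρ! n j * r, mul_mem (mul_mem (hle _ (hdesc j i))
      (rho_mem_rhoSubgroup (by omega))) hr, ?_, ?_, ?_⟩
    · rw [map_mul, map_mul, Equiv.Perm.mul_apply, Equiv.Perm.mul_apply, h0,
        hμ.map_rho (by omega), Equiv.swap_apply_left, happ h hi]
    · rw [map_mul, map_mul, Equiv.Perm.mul_apply, Equiv.Perm.mul_apply, h1,
        hμ.map_rho (by omega), Equiv.swap_apply_right,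
        hμ.map_apply_of_mem (hdesc j i) (by simp)]
    · rw [xV, if_neg (by simpa using h.le), ascProd_eq_inv, ← hc]
      calc _ = descProd n j i * ((ρ! n j) * (r * σ! n 0 * r⁻¹) * (ρ! n j)⁻¹) *
            (descProd n j i)⁻¹ := by group
        _ = _ := by rw [rho_inv]

/-- The elements `x_{i,j}` are permuted by the `ρ`-subgroup under conjugation. -/
theorem IsMu.conj_xV (hμ : IsMu n μ) (hn : 2 ≤ n) {r : VB n} (hr : r ∈ rhoSubgroup n 0)
    {i j : Fin n} (hij : i ≠ j) : r * xV n i j * r⁻¹ = xV n (μ r i) (μ r j) := by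
  obtain ⟨s, hs, rfl, rfl, h⟩ := hμ.exists_conj_xV hn hij
  obtain ⟨t, ht, ht0, ht1, h'⟩ := hμ.exists_conj_xV hn ((μ r).injective.ne hij)
  rw [← h, ← h', hμ.conj_sigma_zero_eq hn ht (mul_mem hr hs) (by simp [ht0]) (by simp [ht1])]
  group

theorem xV_self_succ (i : ℕ) : xV n i (i + 1) = σ! n i := by
  simp [xV, descProd, ascProd]

theorem IsMu.map_xV (hμ : IsMu n μ) (hn : 2 ≤ n) {i j : Fin n} (hij : i ≠ j) :
    μ (xV n i j) = 1 := by
  obtain ⟨r, -, -, -, h⟩ := hμ.exists_conj_xV hn hij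
  simp [← h, hμ.map_sigma]

theorem IsMu.exists_rhoSubgroup_map_eq (hμ : IsMu n μ) (g : Equiv.Perm (Fin n)) :
    ∃ r ∈ rhoSubgroup n 0, μ r = g := by
  obtain _ | m := n
  · exact ⟨1, one_mem _, Subsingleton.elim _ _⟩
  · have hg : g ∈ Submonoid.closure
        (Set.range fun i : Fin m => Equiv.swap i.castSucc i.succ) := by
      rw [Equiv.Perm.mclosure_swap_castSucc_succ]; trivial
    induction hg using Submonoid.closure_induction with
    | mem g hg =>
      obtain ⟨k, rfl⟩ := hg
      exact ⟨_, rho_mem_rhoSubgroup (Nat.zero_le k.1), hμ.map_rho k.2⟩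
    | one => exact ⟨1, one_mem _, map_one μ⟩
    | mul a b _ _ ha hb =>
      obtain ⟨r, hr, rfl⟩ := ha
      obtain ⟨s, hs, rfl⟩ := hb
      exact ⟨r * s, mul_mem hr hs, map_mul μ r s⟩

theorem IsMu.exists_map_comp_eq (hμ : IsMu n μ) {m : ℕ} (hm : m ≤ n) {f : Fin m → Fin n}
    (hf : Function.Injective f) :
    ∃ r ∈ rhoSubgroup n 0, ∀ a : Fin m, μ r (a.castLE hm) = f a := by
  have := Equiv.Perm.isMultiplyPretransitive (Fin n) m
  obtain ⟨g, hg⟩ := MulAction.exists_smul_eq (Equiv.Perm (Fin n)) (Fin.castLEEmb hm) ⟨f, hf⟩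
  obtain ⟨r, hr, rfl⟩ := hμ.exists_rhoSubgroup_map_eq g
  exact ⟨r, hr, fun a => DFunLike.congr_fun hg a⟩

theorem IsMu.xV_comm (hμ : IsMu n μ) {i j k l : Fin n} (hij : i ≠ j) (hkl : k ≠ l)
    (hik : i ≠ k) (hil : i ≠ l) (hjk : j ≠ k) (hjl : j ≠ l) :
    xV n i j * xV n k l = xV n k l * xV n i j := by
  have hf : Function.Injective ![i, j, k, l] := by
    intro a b
    fin_cases a <;> fin_cases b <;> simp_all [eq_comm]
  have hn : 4 ≤ n := by simpa using Fintype.card_le_of_injective _ hf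
  obtain ⟨r, hr, h⟩ := hμ.exists_map_comp_eq hn hf
  have h0 := h 0
  have h1 := h 1
  have h2 := h 2
  have h3 := h 3
  simp at h0 h1 h2 h3
  rw [← h0, ← h1, ← h2, ← h3, ← hμ.conj_xV (by omega) hr (by simp [Fin.ext_iff]),
    ← hμ.conj_xV (by omega) hr (by simp [Fin.ext_iff])]
  have := sigma_comm (n := n) (i := 0) (j := 2) le_rfl
  rw [← xV_self_succ, ← xV_self_succ] at this
  simpa using this

theorem IsMu.xV_braid (hμ : IsMu n μ) {i j k : Fin n} (hij : i ≠ j) (hki : k ≠ i)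
    (hkj : k ≠ j) :
    xV n i k * xV n k j * xV n i k = xV n k j * xV n i k * xV n k j := by
  have hf : Function.Injective ![i, k, j] := by
    intro a b
    fin_cases a <;> fin_cases b <;> simp_all [eq_comm]
  have hn : 3 ≤ n := by simpa using Fintype.card_le_of_injective _ hf
  obtain ⟨r, hr, h⟩ := hμ.exists_map_comp_eq hn hf
  have h0 := h 0
  have h1 := h 1
  have h2 := h 2
  simp at h0 h1 h2
  rw [← h0, ← h1, ← h2, ← hμ.conj_xV (by omega) hr (by simp [Fin.ext_iff]),
    ← hμ.conj_xV (by omega) hr (by simp [Fin.ext_iff])]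
  have := sigma_braid (n := n) (i := 0) (by omega)
  rw [← xV_self_succ, ← xV_self_succ] at this
  simpa using this

end Action

namespace K

variable {n : ℕ}

/-- The element `x_{i,j}` of `K n` (equal to `1` when `i = j`). -/
def gen (i j : Fin n) : K n := PresentedGroup.mk (KRels n) (Xg n i j)

theorem gen_of_ne {i j : Fin n} (h : i ≠ j) :
    gen i j = PresentedGroup.of (rels := KRels n) ⟨(i, j), h⟩ := by
  simp only [gen, Xg, h, dif_neg, not_false_eq_true]
  rfl

theorem gen_comm {i j k l : Fin n} (hij : i ≠ j) (hkl : k ≠ l)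
    (hik : i ≠ k) (hil : i ≠ l) (hjk : j ≠ k) (hjl : j ≠ l) :
    gen i j * gen k l = gen k l * gen i j :=
  PresentedGroup.mk_eq_mk_of_mul_inv_mem (x := Xg n i j * Xg n k l) (y := Xg n k l * Xg n i j)
    (Or.inl ⟨i, j, k, l, hij, hkl, hik, hil, hjk, hjl, rfl⟩)

theorem gen_braid {i j k : Fin n} (hij : i ≠ j) (hki : k ≠ i) (hkj : k ≠ j) :
    gen i k * gen k j * gen i k = gen k j * gen i k * gen k j :=
  PresentedGroup.mk_eq_mk_of_mul_inv_mem (x := Xg n i k * Xg n k j * Xg n i k)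
    (y := Xg n k j * Xg n i k * Xg n k j) (Or.inr ⟨i, j, k, hij, hki, hkj, rfl⟩)

variable {G : Type*} [Group G]

/-- A family `f i j` satisfying the relations of `K n` induces a homomorphism out of `K n`. -/
def lift (f : Fin n → Fin n → G)
    (comm : ∀ i j k l, i ≠ j → k ≠ l → i ≠ k → i ≠ l → j ≠ k → j ≠ l →
      f i j * f k l = f k l * f i j)
    (braid : ∀ i j k, i ≠ j → k ≠ i → k ≠ j → f i k * f k j * f i k = f k j * f i k * f k j) :
    K n →* G :=
  PresentedGroup.toGroup (f := fun p : KGenIdx n => f p.1.1 p.1.2) <| by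
    have hX {i j : Fin n} (h : i ≠ j) :
        FreeGroup.lift (fun p : KGenIdx n => f p.1.1 p.1.2) (Xg n i j) = f i j := by
      rw [Xg, dif_neg h]
      exact FreeGroup.lift_apply_of
    rintro r (⟨i, j, k, l, hij, hkl, hik, hil, hjk, hjl, rfl⟩ | ⟨i, j, k, hij, hki, hkj, rfl⟩)
    · rw [map_mul, map_inv, mul_inv_eq_one, map_mul, map_mul, hX hij, hX hkl]
      exact comm i j k l hij hkl hik hil hjk hjl
    · rw [map_mul, map_inv, mul_inv_eq_one]
      simp only [map_mul, hX hki.symm, hX hkj]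
      exact braid i j k hij hki hkj

theorem lift_gen {f : Fin n → Fin n → G} {comm braid} {i j : Fin n} (h : i ≠ j) :
    lift f comm braid (gen i j) = f i j := by
  rw [gen_of_ne h]
  exact PresentedGroup.toGroup.of _

theorem hom_ext {f g : K n →* G} (h : ∀ i j, i ≠ j → f (gen i j) = g (gen i j)) : f = g := by
  ext ⟨⟨i, j⟩, hij⟩
  rw [← gen_of_ne hij, h i j hij]

/-- The endomorphism of `K n` permuting the indices of the generators. -/
def permHom (g : Equiv.Perm (Fin n)) : K n →* K n :=
  lift (fun i j => gen (g i) (g j))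
    (fun i j k l _ _ _ _ _ _ => by apply gen_comm <;> simpa)
    (fun i j k _ _ _ => by apply gen_braid <;> simpa)

theorem permHom_gen (g : Equiv.Perm (Fin n)) {i j : Fin n} (h : i ≠ j) :
    permHom g (gen i j) = gen (g i) (g j) := lift_gen h

theorem permHom_mul (g h : Equiv.Perm (Fin n)) : permHom (g * h) = (permHom g).comp (permHom h) :=
  hom_ext fun i j hij => by
    simp [permHom_gen _ hij, permHom_gen _ (h.injective.ne hij)]

theorem permHom_one : permHom (1 : Equiv.Perm (Fin n)) = MonoidHom.id (K n) :=
  hom_ext fun i j hij => by simp [permHom_gen _ hij]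

/-- The action of the symmetric group on `K n` by permuting the indices of the generators. -/
def permAut : Equiv.Perm (Fin n) →* MulAut (K n) where
  toFun g := (permHom g).toMulEquiv (permHom g⁻¹)
    (by rw [← permHom_mul, inv_mul_cancel, permHom_one])
    (by rw [← permHom_mul, mul_inv_cancel, permHom_one])
  map_one' := by
    ext x
    exact DFunLike.congr_fun permHom_one x
  map_mul' g h := by
    ext x
    exact DFunLike.congr_fun (permHom_mul g h) x

theorem permAut_gen (g : Equiv.Perm (Fin n)) {i j : Fin n} (h : i ≠ j) :
    permAut g (gen i j) = gen (g i) (g j) := permHom_gen g h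

end K

theorem swap_braid_s12 {α : Type*} [DecidableEq α] {a b c : α} (hab : a ≠ b) (hac : a ≠ c)
    (hbc : b ≠ c) : Equiv.swap a b * Equiv.swap b c * Equiv.swap a b =
      Equiv.swap b c * Equiv.swap a b * Equiv.swap b c := by
  rw [Equiv.swap_mul_swap_mul_swap hab hac, Equiv.swap_comm a b, Equiv.swap_comm b c,
    Equiv.swap_mul_swap_mul_swap hbc.symm hac.symm, Equiv.swap_comm]

theorem sw_comm {n : ℕ} {i j : Fin (n - 1)} (h : (i : ℕ) + 2 ≤ j ∨ (j : ℕ) + 2 ≤ i) :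
    sw n i * sw n j = sw n j * sw n i := by
  refine Equiv.Perm.Disjoint.commute (Equiv.Perm.disjoint_iff_disjoint_support.mpr ?_)
  rw [sw, sw, Equiv.Perm.support_swap (by simp), Equiv.Perm.support_swap (by simp)]
  simp only [Finset.disjoint_left, Finset.mem_insert, Finset.mem_singleton, Fin.ext_iff]
  omega

/-- The homomorphism from `VB n` to the semidirect product of `K n` and the symmetric group. -/
def toSemidirect (n : ℕ) : VB n →* K n ⋊[K.permAut] Equiv.Perm (Fin n) :=
  PresentedGroup.toGroup (f := Sum.elim
    (fun i : Fin (n - 1) =>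
      SemidirectProduct.inl (K.gen ⟨i, by omega⟩ ⟨i + 1, by omega⟩))
    (fun i : Fin (n - 1) => SemidirectProduct.inr (sw n i))) <| by
  have conj (g : Equiv.Perm (Fin n)) (x : K n) :
      (SemidirectProduct.inr g : K n ⋊[K.permAut] _) * SemidirectProduct.inl x =
        SemidirectProduct.inl (K.permAut g x) * SemidirectProduct.inr g := by
    rw [SemidirectProduct.inl_aut, map_inv, inv_mul_cancel_right]
  rintro r ⟨i, j, ⟨h, rfl⟩ | ⟨h, rfl⟩ | ⟨h, rfl⟩ | ⟨h, rfl⟩ | rfl | ⟨h, rfl⟩ | ⟨h, rfl⟩⟩ <;>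
    simp only [σg, ρg, map_mul, map_inv, mul_inv_eq_one, FreeGroup.lift_apply_of, Sum.elim_inl,
      Sum.elim_inr]
  · rw [← map_mul, ← map_mul, ← map_mul, ← map_mul]
    obtain ⟨j, hj⟩ := j
    obtain rfl : (i : ℕ) + 1 = j := h
    rw [K.gen_braid] <;> simp only [ne_eq, Fin.mk.injEq] <;> omega
  · rw [← map_mul, ← map_mul, K.gen_comm] <;> simp only [ne_eq, Fin.mk.injEq] <;> omega
  · rw [← map_mul, ← map_mul, sw_braid h, map_mul, map_mul]
  · rw [← map_mul, sw_comm h, map_mul]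
  · rw [← map_mul, sw, Equiv.swap_mul_self, map_one]
  · rw [conj, K.permAut_gen _ (by simp), sw, Equiv.swap_apply_of_ne_of_ne,
      Equiv.swap_apply_of_ne_of_ne] <;> simp only [ne_eq, Fin.mk.injEq] <;> omega
  · obtain ⟨j, hj⟩ := j
    obtain rfl : (i : ℕ) + 1 = j := h
    rw [← map_mul, conj, K.permAut_gen _ (by simp), mul_assoc, ← map_mul, Equiv.Perm.mul_apply,
      Equiv.Perm.mul_apply]
    have h1 : sw n ⟨i + 1, hj⟩ ⟨i, by omega⟩ = ⟨i, by omega⟩ :=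
      Equiv.swap_apply_of_ne_of_ne (by simp) (by simp; omega)
    have h2 : sw n ⟨i + 1, hj⟩ ⟨i + 1, by omega⟩ = ⟨i + 1 + 1, by omega⟩ :=
      Equiv.swap_apply_left _ _
    have h3 : sw n i ⟨i, by omega⟩ = ⟨i + 1, by omega⟩ := Equiv.swap_apply_left _ _
    have h4 : sw n i ⟨i + 1 + 1, by omega⟩ = ⟨i + 1 + 1, by omega⟩ :=
      Equiv.swap_apply_of_ne_of_ne (by simp; omega) (by simp)
    rw [h1, h2, h3, h4]

theorem toSemidirect_sigma_zero {n : ℕ} (hn : 2 ≤ n) :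
    toSemidirect n (σ! n 0) = SemidirectProduct.inl (K.gen ⟨0, by omega⟩ ⟨1, by omega⟩) := by
  have h : 0 < n - 1 := by omega
  simp only [σ!, h, dif_pos]
  exact PresentedGroup.toGroup.of _

section Kernel

variable {n : ℕ} {μ : VB n →* Equiv.Perm (Fin n)}

theorem IsMu.toSemidirect_of_mem (hμ : IsMu n μ) {g : VB n} (hg : g ∈ rhoSubgroup n 0) :
    toSemidirect n g = SemidirectProduct.inr (μ g) := by
  induction hg using rhoSubgroup_induction with
  | one => simp
  | mul k g _ hk _ ih =>
    rw [map_mul, map_mul, map_mul, ih, hμ.map_rho hk]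
    congr 1
    simp only [ρ!, hk, dif_pos]
    exact PresentedGroup.toGroup.of _

theorem IsMu.toSemidirect_xV (hμ : IsMu n μ) (hn : 2 ≤ n) {i j : Fin n} (hij : i ≠ j) :
    toSemidirect n (xV n i j) = SemidirectProduct.inl (K.gen i j) := by
  obtain ⟨r, hr, rfl, rfl, h⟩ := hμ.exists_conj_xV hn hij
  rw [← h, map_mul, map_mul, map_inv, hμ.toSemidirect_of_mem hr, toSemidirect_sigma_zero hn,
    ← K.permAut_gen _ (by simp), SemidirectProduct.inl_aut, map_inv]

/-- The homomorphism `K n → VB n` sending `x_{i,j}` to `x_{i,j}`. -/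
def IsMu.fromK (hμ : IsMu n μ) : K n →* VB n :=
  K.lift (fun i j => xV n i j) (fun _ _ _ _ => hμ.xV_comm) (fun _ _ _ => hμ.xV_braid)

theorem IsMu.fromK_gen (hμ : IsMu n μ) {i j : Fin n} (hij : i ≠ j) :
    hμ.fromK (K.gen i j) = xV n i j := K.lift_gen hij

theorem IsMu.fromK_injective (hμ : IsMu n μ) (hn : 2 ≤ n) : Function.Injective hμ.fromK := by
  have h : (toSemidirect n).comp hμ.fromK = SemidirectProduct.inl :=
    K.hom_ext fun i j hij => by simp [hμ.fromK_gen hij, hμ.toSemidirect_xV hn hij]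
  refine Function.Injective.of_comp (f := toSemidirect n) ?_
  rw [← MonoidHom.coe_comp, h]
  exact SemidirectProduct.inl_injective

theorem IsMu.map_fromK (hμ : IsMu n μ) (hn : 2 ≤ n) (x : K n) : μ (hμ.fromK x) = 1 := by
  have h : μ.comp hμ.fromK = 1 :=
    K.hom_ext fun i j hij => by simp [hμ.fromK_gen hij, hμ.map_xV hn hij]
  exact DFunLike.congr_fun h x

theorem IsMu.conj_fromK (hμ : IsMu n μ) (hn : 2 ≤ n) {r : VB n} (hr : r ∈ rhoSubgroup n 0)
    (x : K n) : r * hμ.fromK x * r⁻¹ = hμ.fromK (K.permAut (μ r) x) := by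
  have h : (MulAut.conj r).toMonoidHom.comp hμ.fromK =
      hμ.fromK.comp (K.permAut (μ r)).toMonoidHom :=
    K.hom_ext fun i j hij => by
      simp [hμ.fromK_gen hij, K.permAut_gen _ hij, hμ.fromK_gen ((μ r).injective.ne hij),
        hμ.conj_xV hn hr hij]
  exact DFunLike.congr_fun h x

theorem IsMu.exists_eq_fromK_mul (hμ : IsMu n μ) (hn : 2 ≤ n) (g : VB n) :
    ∃ x, ∃ r ∈ rhoSubgroup n 0, g = hμ.fromK x * r := by
  have hg : g ∈ Subgroup.closure (Set.range (PresentedGroup.of (rels := vbRels n))) := by simp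
  have sigma (i : Fin (n - 1)) : PresentedGroup.of (Sum.inl i) =
      hμ.fromK (K.gen ⟨i, by omega⟩ ⟨i + 1, by omega⟩) := by
    rw [hμ.fromK_gen (by simp), xV_self_succ]
    simp [σ!]
  have rho (i : Fin (n - 1)) : PresentedGroup.of (Sum.inr i) = ρ! n i := by simp [ρ!]
  have step (k : ℕ) (y : VB n) (h : ∃ x, ∃ r ∈ rhoSubgroup n 0, y = hμ.fromK x * r) :
      ∃ x, ∃ r ∈ rhoSubgroup n 0, ρ! n k * y = hμ.fromK x * r := by
    obtain ⟨x, r, hr, rfl⟩ := h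
    have hk : ρ! n k ∈ rhoSubgroup n 0 := rho_mem_rhoSubgroup k.zero_le
    exact ⟨K.permAut (μ (ρ! n k)) x, ρ! n k * r, mul_mem hk hr, by
      rw [← hμ.conj_fromK hn hk]; group⟩
  induction hg using Subgroup.closure_induction_left with
  | one => exact ⟨1, 1, one_mem _, by simp⟩
  | mul_left a ha y _ ih =>
    obtain ⟨i | i, rfl⟩ := ha
    · obtain ⟨x, r, hr, rfl⟩ := ih
      exact ⟨_ * x, r, hr, by rw [sigma, map_mul, mul_assoc]⟩
    · rw [rho]
      exact step _ _ ih
  | inv_mul_cancel a ha y _ ih =>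
    obtain ⟨i | i, rfl⟩ := ha
    · obtain ⟨x, r, hr, rfl⟩ := ih
      exact ⟨_⁻¹ * x, r, hr, by rw [sigma, map_mul, map_inv, mul_assoc]⟩
    · rw [rho, rho_inv]
      exact step _ _ ih

end Kernel

/-- For every `n ≥ 2`, the group `H_n = ker μ` (the normal closure of
`B_n` in `VB_n`) is isomorphic to the abstractly presented group `K_n`, by an isomorphism
sending the generator `x_{k,l}` of `K_n` to the element `x_{k,l}` of `VB_n`. -/
theorem hn_presentation (n : ℕ) (hn : 2 ≤ n)
    (μ : VB n →* Equiv.Perm (Fin n)) (hμ : IsMu n μ) :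
    ∃ e : K n ≃* μ.ker, ∀ (i j : Fin n) (h : i ≠ j),
      ((e (PresentedGroup.of ⟨(i, j), h⟩) : μ.ker) : VB n) = xV n i j := by
  have hmem (x : K n) : hμ.fromK x ∈ μ.ker := hμ.map_fromK hn x
  refine ⟨MulEquiv.ofBijective (hμ.fromK.codRestrict μ.ker hmem) ⟨?_, ?_⟩, ?_⟩
  · exact fun x y hxy => hμ.fromK_injective hn (congrArg Subtype.val hxy)
  · rintro ⟨g, hg⟩
    obtain ⟨x, r, hr, rfl⟩ := hμ.exists_eq_fromK_mul hn g
    rw [MonoidHom.mem_ker, map_mul, hμ.map_fromK hn, one_mul] at hg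
    exact ⟨x, Subtype.ext (by simp [hμ.eq_one_of_mem hr hg])⟩
  · intro i j h
    rw [← K.gen_of_ne h]
    exact hμ.fromK_gen h
end
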